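/- There is a universal constant c > 0 such that the following holds for every integer V > 0, every ε > 0 less than a sufficiently small universal constant, and every k ≤ V: any (possibly randomized) test that takes m i.i.d. samples from each of two distributions p, q on [V]×[V] and, for every such pair, distinguishes p = q from ‖p − q‖_{A_k} ≥ ε with success probability at least 2/3, must satisfy m ≥ c·min( k^(2/3)·ε^(−4/3)·(log log V / log log log V)^(1/3), k^(6/7)·ε^(−8/7), k ). -/

import Mathlib

open MeasureTheory

/-- An axis-aligned rectangle in `ℝ^d` is a product of `d` intervals. -/
def IsAxisAlignedRectangle {d : ℕ} (R : Set (Fin d → ℝ)) : Prop :=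
  ∃ I : Fin d → Set ℝ, (∀ i, (I i).OrdConnected) ∧ R = Set.univ.pi I

/-- The `A_k` distance between two measures on `ℝ^d`. -/
noncomputable def AkDist {d : ℕ} (k : ℕ) (p q : Measure (Fin d → ℝ)) : ℝ :=
  ⨆ R : {R : Fin k → Set (Fin d → ℝ) //
      (∀ i, IsAxisAlignedRectangle (R i)) ∧
      Pairwise fun i j => Disjoint (R i) (R j)},
    ∑ i, |(p (R.1 i)).toReal - (q (R.1 i)).toReal|

/-- A measure on `ℝ²` is supported on the grid `[V] × [V]`. -/
def GridSupported (V : ℕ) (p : Measure (Fin 2 → ℝ)) : Prop :=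
  p {x | ∀ i, ∃ j : Fin V, x i = (j : ℝ) + 1}ᶜ = 0

theorem sum_prod_fiber {I J X : Type*} [Fintype I] [Fintype J] [Fintype X]
    [DecidableEq I] [DecidableEq J] (a : I → J) (g : ∀ j, ({i // a i = j} → X) → ℝ) :
    ∑ ξ : I → X, ∏ j, g j (fun i => ξ i) = ∏ j, ∑ η, g j η := by
  rw [Finset.prod_univ_sum, Fintype.piFinset_univ]
  let e : (I → X) ≃ (∀ j, {i // a i = j} → X) :=
    { toFun := fun ξ j i => ξ i
      invFun := fun p i => p (a i) ⟨i, rfl⟩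
      left_inv := fun ξ => rfl
      right_inv := fun p => by
        funext j ⟨i, hi⟩
        subst hi
        rfl }
  exact Fintype.sum_equiv e _ _ fun ξ => rfl

theorem sq_sum_abs_sub_le {Ω : Type*} [Fintype Ω] (u v : Ω → ℝ) (Z : ℝ)
    (hu : ∀ x, 0 ≤ u x) (hv : ∀ x, 0 ≤ v x) (hsu : ∑ x, u x = Z) (hsv : ∑ x, v x = Z) :
    (∑ x, |u x - v x|) ^ 2 ≤ 8 * Z * (Z - ∑ x, √(u x) * √(v x)) := by
  have h1 : ∑ x, |u x - v x| = ∑ x, |√(u x) - √(v x)| * (√(u x) + √(v x)) := by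
    refine Finset.sum_congr rfl fun x _ => ?_
    rw [← abs_of_nonneg (add_nonneg (Real.sqrt_nonneg (u x)) (Real.sqrt_nonneg (v x))),
      ← abs_mul]
    congr 1
    have h1 := Real.mul_self_sqrt (hu x)
    have h2 := Real.mul_self_sqrt (hv x)
    linear_combination -h1 + h2
  have h2 := Finset.sum_mul_sq_le_sq_mul_sq Finset.univ (fun x => |√(u x) - √(v x)|)
    (fun x => √(u x) + √(v x))
  have h3 : ∑ x, |√(u x) - √(v x)| ^ 2 = 2 * Z - 2 * ∑ x, √(u x) * √(v x) := by
    rw [Finset.mul_sum]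
    have : 2 * Z = ∑ x, (u x + v x) := by rw [Finset.sum_add_distrib]; linarith
    rw [this, ← Finset.sum_sub_distrib]
    refine Finset.sum_congr rfl fun x _ => ?_
    rw [sq_abs]
    have h1 := Real.mul_self_sqrt (hu x)
    have h2 := Real.mul_self_sqrt (hv x)
    linear_combination h1 + h2
  have h4 : ∑ x, (√(u x) + √(v x)) ^ 2 ≤ 4 * Z := by
    have : 4 * Z = ∑ x, (2 * u x + 2 * v x) := by
      rw [Finset.sum_add_distrib, ← Finset.mul_sum, ← Finset.mul_sum]; linarith
    rw [this]
    refine Finset.sum_le_sum fun x _ => ?_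
    have h1 := Real.mul_self_sqrt (hu x)
    have h2 := Real.mul_self_sqrt (hv x)
    nlinarith [sq_nonneg (√(u x) - √(v x))]
  have h5 : 0 ≤ ∑ x, |√(u x) - √(v x)| ^ 2 := Finset.sum_nonneg fun x _ => by positivity
  rw [h1]
  refine h2.trans ?_
  calc _ ≤ (∑ x, |√(u x) - √(v x)| ^ 2) * (4 * Z) := mul_le_mul_of_nonneg_left h4 h5
    _ = _ := by rw [h3]; ring

theorem prod_sub_sum_le_prod_sub {J : Type*} [DecidableEq J] (s : Finset J) (w H : J → ℝ)
    (h0 : ∀ j, 0 ≤ H j) (h1 : ∀ j, H j ≤ w j) :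
    ∏ j ∈ s, w j - ∑ j ∈ s, H j * ∏ l ∈ s.erase j, w l ≤ ∏ j ∈ s, (w j - H j) := by
  induction s using Finset.induction_on with
  | empty => simp
  | insert b s hb ih =>
    have hw : ∀ j, 0 ≤ w j := fun j => (h0 j).trans (h1 j)
    rw [Finset.prod_insert hb, Finset.prod_insert hb, Finset.sum_insert hb,
      Finset.erase_insert hb]
    have h2 : ∑ j ∈ s, H j * ∏ l ∈ (insert b s).erase j, w l
        = w b * ∑ j ∈ s, H j * ∏ l ∈ s.erase j, w l := by
      rw [Finset.mul_sum]
      refine Finset.sum_congr rfl fun j hj => ?_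
      have hjb : b ≠ j := fun h => hb (h ▸ hj)
      rw [Finset.erase_insert_of_ne hjb, Finset.prod_insert (by simp [hb])]
      ring
    rw [h2]
    have h3 : ∏ j ∈ s, (w j - H j) ≤ ∏ j ∈ s, w j :=
      Finset.prod_le_prod (fun j _ => sub_nonneg.2 (h1 j)) fun j _ => by linarith [h0 j]
    nlinarith [mul_le_mul_of_nonneg_left ih (hw b), mul_le_mul_of_nonneg_left h3 (h0 b)]

/-- Unnormalised mixture likelihood of the points `η` falling in one cell. -/
def cellLik {ι Φ X : Type*} [Fintype ι] [Fintype Φ] (π : Φ → ℝ) (U : ι → Φ → X → ℝ)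
    (η : ι → X) : ℝ :=
  ∑ φ, π φ * ∏ i, U i φ (η i)

/-- Unnormalised mixture likelihood of samples with cells `a` and points `ξ`. -/
def mixLik {I J Φ X : Type*} [Fintype I] [Fintype J] [DecidableEq J] [Fintype Φ] (π : Φ → ℝ)
    (U : J → I → Φ → X → ℝ) (a : I → J) (ξ : I → X) : ℝ :=
  ∑ ϑ : J → Φ, (∏ j, π (ϑ j)) * ∏ i, U (a i) i (ϑ (a i)) (ξ i)

theorem mixLik_eq_prod {I J Φ X : Type*} [Fintype I] [Fintype J] [DecidableEq J] [Fintype Φ]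
    (π : Φ → ℝ) (U : J → I → Φ → X → ℝ) (a : I → J) (ξ : I → X) :
    mixLik π U a ξ =
      ∏ j, cellLik π (fun (i : {i // a i = j}) => U j i) (fun i => ξ i) := by
  unfold mixLik cellLik
  rw [Finset.prod_univ_sum, Fintype.piFinset_univ]
  refine Finset.sum_congr rfl fun ϑ _ => ?_
  rw [Finset.prod_mul_distrib]
  congr 1
  rw [← Fintype.prod_fiberwise a]
  refine Finset.prod_congr rfl fun j _ => Finset.prod_congr rfl fun i _ => ?_
  rw [i.2]

section Mixture

variable {I J Φ X : Type*} [Fintype I] [Fintype J] [Fintype Φ] [Fintype X]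
  [DecidableEq I] [DecidableEq J]

theorem sum_cellLik {ι : Type*} [Fintype ι] [DecidableEq ι] (π : Φ → ℝ) (U : ι → Φ → X → ℝ)
    (α : Φ → ℝ) (hU : ∀ i φ, ∑ x, U i φ x = α φ) :
    ∑ η, cellLik π U η = ∑ φ, π φ * α φ ^ Fintype.card ι := by
  unfold cellLik
  rw [Finset.sum_comm]
  refine Finset.sum_congr rfl fun φ _ => ?_
  rw [← Finset.mul_sum, ← Fintype.piFinset_univ, ← Finset.prod_univ_sum]
  simp [hU]

theorem sum_prod_cellMass (π α : J → Φ → ℝ) :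
    ∑ a : I → J, ∏ j, ∑ φ, π j φ * α j φ ^ Fintype.card {i // a i = j} =
      ∑ ϑ : J → Φ, (∏ j, π j (ϑ j)) * (∑ j, α j (ϑ j)) ^ Fintype.card I := by
  have h : ∀ a : I → J, ∏ j, ∑ φ, π j φ * α j φ ^ Fintype.card {i // a i = j} =
      ∑ ϑ : J → Φ, (∏ j, π j (ϑ j)) * ∏ i, α (a i) (ϑ (a i)) := by
    intro a
    rw [Finset.prod_univ_sum, Fintype.piFinset_univ]
    refine Finset.sum_congr rfl fun ϑ _ => ?_
    rw [Finset.prod_mul_distrib]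
    congr 1
    rw [← Fintype.prod_fiberwise a]
    refine Finset.prod_congr rfl fun j _ => ?_
    rw [Finset.prod_congr rfl (g := fun _ => α j (ϑ j)) fun i _ => by rw [i.2]]
    simp
  simp_rw [h]
  rw [Finset.sum_comm]
  refine Finset.sum_congr rfl fun ϑ _ => ?_
  rw [← Finset.mul_sum, ← Fintype.piFinset_univ,
    ← Finset.prod_univ_sum (fun _ => Finset.univ) (fun (_ : I) j => α j (ϑ j))]
  simp

theorem sum_cell_mul_prod_erase_le (π : Φ → ℝ) (α : J → Φ → ℝ) (hπ : ∀ φ, 0 ≤ π φ)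
    (hπ1 : ∑ φ, π φ = 1) (hα : ∀ j φ, 0 ≤ α j φ) (τ : ℝ) (hτ : 0 < τ) (j₀ : J)
    (hj₀ : ∀ φ, α j₀ φ = τ) (h : ℕ → ℝ) (hh : ∀ s, 0 ≤ h s) (b : J) :
    ∑ a : I → J, h (Fintype.card {i // a i = b}) *
        ∏ j ∈ Finset.univ.erase b, ∑ φ, π φ * α j φ ^ Fintype.card {i // a i = j} ≤
      (∑ ϑ : J → Φ, (∏ j, π (ϑ j)) * (∑ j, α j (ϑ j)) ^ Fintype.card I) *
        ∑ s ∈ Finset.range (Fintype.card I + 1),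
          (Fintype.card I).choose s * ((1 / τ) ^ s * h s) := by
  have h1 : ∀ a : I → J,
      ∏ j ∈ Finset.univ.erase b, ∑ φ, π φ * α j φ ^ Fintype.card {i // a i = j} =
      ∑ ϑ : J → Φ, (∏ j, π (ϑ j)) * ∏ i, if a i = b then 1 else α (a i) (ϑ (a i)) := by
    intro a
    have e : ∀ j, ∑ φ, π φ * (if j = b then 1 else α j φ) ^ Fintype.card {i // a i = j} =
        if j = b then 1 else ∑ φ, π φ * α j φ ^ Fintype.card {i // a i = j} := by
      intro j
      split_ifs <;> simp [hπ1]
    have e2 : ∏ j ∈ Finset.univ.erase b, ∑ φ, π φ * α j φ ^ Fintype.card {i // a i = j} =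
        ∏ j, ∑ φ, π φ * (if j = b then 1 else α j φ) ^ Fintype.card {i // a i = j} := by
      simp_rw [e]
      rw [← Finset.mul_prod_erase Finset.univ _ (Finset.mem_univ b)]
      simp only [if_true, one_mul]
      refine Finset.prod_congr rfl fun j hj => ?_
      rw [if_neg (Finset.ne_of_mem_erase hj)]
    rw [e2, Finset.prod_univ_sum, Fintype.piFinset_univ]
    refine Finset.sum_congr rfl fun ϑ _ => ?_
    rw [Finset.prod_mul_distrib]
    congr 1
    rw [← Fintype.prod_fiberwise a]
    refine Finset.prod_congr rfl fun j _ => ?_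
    rw [Finset.prod_congr rfl (g := fun _ => if j = b then 1 else α j (ϑ j))
      fun i _ => by rw [i.2]]
    simp
  simp_rw [h1, Finset.mul_sum (Finset.univ : Finset (J → Φ))]
  rw [Finset.sum_comm, Finset.sum_mul]
  refine Finset.sum_le_sum fun ϑ _ => ?_
  have hw0 : τ ≤ ∑ j, α j (ϑ j) := by
    rw [← hj₀ (ϑ j₀)]
    exact Finset.single_le_sum (f := fun j => α j (ϑ j)) (fun j _ => hα _ _) (Finset.mem_univ j₀)
  set w := ∑ j, α j (ϑ j)
  have hP : 0 ≤ ∏ j, π (ϑ j) := Finset.prod_nonneg fun j _ => hπ _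
  simp_rw [mul_left_comm (h _), ← Finset.mul_sum (Finset.univ : Finset (I → J)), mul_assoc]
  refine mul_le_mul_of_nonneg_left ?_ hP
  rw [← Finset.sum_fiberwise_of_maps_to (s := Finset.univ) (t := Finset.univ.powerset)
    (g := fun a : I → J => Finset.univ.filter fun i => a i = b) (by simp)]
  have hcard : (Fintype.card I) = (Finset.univ : Finset I).card := rfl
  have h2 : w ^ Fintype.card I * ∑ s ∈ Finset.range (Fintype.card I + 1),
          (Fintype.card I).choose s * ((1 / τ) ^ s * h s) =
      ∑ S ∈ (Finset.univ : Finset I).powerset,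
        w ^ Fintype.card I * ((1 / τ) ^ S.card * h S.card) := by
    rw [Finset.sum_powerset_apply_card (fun s => w ^ Fintype.card I * ((1 / τ) ^ s * h s)),
      Finset.mul_sum, hcard]
    refine Finset.sum_congr rfl fun s _ => ?_
    rw [nsmul_eq_mul]
    ring
  rw [h2]
  refine Finset.sum_le_sum fun S _ => ?_
  have h3 : Finset.univ.filter (fun a : I → J => (Finset.univ.filter fun i => a i = b) = S) =
      Fintype.piFinset fun i => if i ∈ S then {b} else Finset.univ.erase b := by
    ext a
    simp only [Finset.mem_filter, Finset.mem_univ, true_and, Fintype.mem_piFinset, Finset.ext_iff]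
    refine forall_congr' fun i => ?_
    by_cases hi : i ∈ S <;> simp [hi]
  have h4 : ∑ a ∈ Finset.univ.filter
        (fun a : I → J => (Finset.univ.filter fun i => a i = b) = S),
        h (Fintype.card {i // a i = b}) * ∏ i, (if a i = b then 1 else α (a i) (ϑ (a i))) =
      h S.card * ∏ i, ∑ j ∈ (if i ∈ S then {b} else Finset.univ.erase b),
        if j = b then 1 else α j (ϑ j) := by
    rw [Finset.prod_univ_sum, ← h3, Finset.mul_sum]
    refine Finset.sum_congr rfl fun a ha => ?_
    rw [← (Finset.mem_filter.1 ha).2, Fintype.card_subtype]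
  rw [h4]
  have h5 : ∏ i, ∑ j ∈ (if i ∈ S then {b} else Finset.univ.erase b),
        (if j = b then 1 else α j (ϑ j)) ≤ ∏ i, if i ∈ S then 1 else w := by
    refine Finset.prod_le_prod (fun i _ => Finset.sum_nonneg fun j _ => ?_) fun i _ => ?_
    · split_ifs
      · exact zero_le_one
      · exact hα _ _
    · by_cases hi : i ∈ S
      · simp [hi]
      · simp only [hi, if_false]
        calc _ = ∑ j ∈ Finset.univ.erase b, α j (ϑ j) :=
              Finset.sum_congr rfl fun j hj => if_neg (Finset.ne_of_mem_erase hj)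
          _ ≤ w := Finset.sum_le_univ_sum_of_nonneg fun j => hα _ _
  have h6 : (∏ i, if i ∈ S then 1 else w) ≤ w ^ Fintype.card I * (1 / τ) ^ S.card := by
    have : w ^ Fintype.card I * (1 / τ) ^ S.card =
        ∏ i : I, w * (if i ∈ S then 1 / τ else 1) := by
      rw [Finset.prod_mul_distrib]
      simp [Finset.prod_ite_mem]
    rw [this]
    have hw : 0 ≤ w := hτ.le.trans hw0
    refine Finset.prod_le_prod (fun i _ => by split_ifs <;> positivity) fun i _ => ?_
    split_ifs
    · rw [mul_one_div, le_div_iff₀ hτ]; linarith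
    · simp
  calc _ ≤ h S.card * (w ^ Fintype.card I * (1 / τ) ^ S.card) :=
        mul_le_mul_of_nonneg_left (h5.trans h6) (hh _)
    _ = _ := by ring

/-- The two mixtures are close as soon as, in each cell, their likelihoods are Hellinger close. -/
theorem sq_sum_abs_mixLik_sub_le (π : Φ → ℝ) (U₀ U₁ : J → I → Φ → X → ℝ) (α : J → Φ → ℝ)
    (hπ : ∀ φ, 0 ≤ π φ) (hπ1 : ∑ φ, π φ = 1) (hU₀ : ∀ j i φ x, 0 ≤ U₀ j i φ x)
    (hU₁ : ∀ j i φ x, 0 ≤ U₁ j i φ x) (hα₀ : ∀ j i φ, ∑ x, U₀ j i φ x = α j φ)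
    (hα₁ : ∀ j i φ, ∑ x, U₁ j i φ x = α j φ) (hα : ∀ j φ, 0 ≤ α j φ) (τ : ℝ) (hτ : 0 < τ)
    (j₀ : J) (hj₀ : ∀ φ, α j₀ φ = τ) (hU : U₀ j₀ = U₁ j₀) (h : ℕ → ℝ) (hh : ∀ s, 0 ≤ h s)
    (hH : ∀ (a : I → J) (j : J), j ≠ j₀ →
      ∑ η, (√(cellLik π (fun (i : {i // a i = j}) => U₀ j i) η) -
        √(cellLik π (fun (i : {i // a i = j}) => U₁ j i) η)) ^ 2 ≤
          2 * h (Fintype.card {i // a i = j})) :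
    (∑ a : I → J, ∑ ξ : I → X, |mixLik π U₀ a ξ - mixLik π U₁ a ξ|) ^ 2 ≤
      8 * (∑ ϑ : J → Φ, (∏ j, π (ϑ j)) * (∑ j, α j (ϑ j)) ^ Fintype.card I) ^ 2 *
        ((Finset.univ.erase j₀).card * ∑ s ∈ Finset.range (Fintype.card I + 1),
          (Fintype.card I).choose s * ((1 / τ) ^ s * h s)) := by
  classical
  set Z := ∑ ϑ : J → Φ, (∏ j, π (ϑ j)) * (∑ j, α j (ϑ j)) ^ Fintype.card I with hZ
  have hZ' := sum_prod_cellMass (I := I) (fun _ => π) α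
  rw [← hZ] at hZ'
  have hc : ∀ (U : J → I → Φ → X → ℝ), (∀ j i φ x, 0 ≤ U j i φ x) → ∀ (a : I → J) j η,
      0 ≤ cellLik π (fun (i : {i // a i = j}) => U j i) η := fun U h0 a j η =>
    Finset.sum_nonneg fun φ _ => mul_nonneg (hπ φ) (Finset.prod_nonneg fun i _ => h0 _ _ _ _)
  have hsum : ∀ (U : J → I → Φ → X → ℝ), (∀ j i φ, ∑ x, U j i φ x = α j φ) →
      ∀ a : I → J, ∑ ξ : I → X, mixLik π U a ξ =
        ∏ j, ∑ φ, π φ * α j φ ^ Fintype.card {i // a i = j} := by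
    intro U hs a
    simp_rw [mixLik_eq_prod]
    rw [sum_prod_fiber a fun j η => cellLik π (fun (i : {i // a i = j}) => U j i) η]
    exact Finset.prod_congr rfl fun j _ => sum_cellLik π _ (α j) fun i φ => hs j i φ
  have hm : ∀ (U : J → I → Φ → X → ℝ), (∀ j i φ x, 0 ≤ U j i φ x) → ∀ (a : I → J) ξ,
      0 ≤ mixLik π U a ξ := fun U h0 a ξ => by
    rw [mixLik_eq_prod]; exact Finset.prod_nonneg fun j _ => hc U h0 a j _
  have key := sq_sum_abs_sub_le (Ω := (I → J) × (I → X)) (fun p => mixLik π U₀ p.1 p.2)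
    (fun p => mixLik π U₁ p.1 p.2) Z (fun p => hm U₀ hU₀ _ _) (fun p => hm U₁ hU₁ _ _)
    (by rw [Fintype.sum_prod_type, ← hZ']; exact Finset.sum_congr rfl fun a _ => hsum _ hα₀ a)
    (by rw [Fintype.sum_prod_type, ← hZ']; exact Finset.sum_congr rfl fun a _ => hsum _ hα₁ a)
  simp only [Fintype.sum_prod_type] at key
  set S := ∑ s ∈ Finset.range (Fintype.card I + 1),
          (Fintype.card I).choose s * ((1 / τ) ^ s * h s)
  have hZ0 : 0 ≤ Z := Finset.sum_nonneg fun ϑ _ => mul_nonneg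
    (Finset.prod_nonneg fun j _ => hπ _) (pow_nonneg (Finset.sum_nonneg fun j _ => hα _ _) _)
  suffices hBC : Z - ∑ a : I → J, ∑ ξ : I → X, √(mixLik π U₀ a ξ) * √(mixLik π U₁ a ξ) ≤
      Z * ((Finset.univ.erase j₀).card * S) by
    calc _ ≤ _ := key
      _ ≤ 8 * Z * (Z * ((Finset.univ.erase j₀).card * S)) :=
        mul_le_mul_of_nonneg_left hBC (by positivity)
      _ = _ := by ring
  let H : (I → J) → J → ℝ := fun a j => (∑ η,
    (√(cellLik π (fun (i : {i // a i = j}) => U₀ j i) η) -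
        √(cellLik π (fun (i : {i // a i = j}) => U₁ j i) η)) ^ 2) / 2
  let ω : (I → J) → J → ℝ := fun a j => ∑ φ, π φ * α j φ ^ Fintype.card {i // a i = j}
  have hH0 : ∀ a j, 0 ≤ H a j := fun a j => by positivity
  have hbc : ∀ a j, ∑ η, √(cellLik π (fun (i : {i // a i = j}) => U₀ j i) η) *
        √(cellLik π (fun (i : {i // a i = j}) => U₁ j i) η) = ω a j - H a j := by
    intro a j
    have e0 := sum_cellLik (X := X) π (fun (i : {i // a i = j}) => U₀ j i) (α j)
      fun i φ => hα₀ j i φ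
    have e1 := sum_cellLik (X := X) π (fun (i : {i // a i = j}) => U₁ j i) (α j)
      fun i φ => hα₁ j i φ
    have : ω a j = (∑ η, (cellLik π (fun (i : {i // a i = j}) => U₀ j i) η +
        cellLik π (fun (i : {i // a i = j}) => U₁ j i) η)) / 2 := by
      rw [Finset.sum_add_distrib, e0, e1]; simp [ω]
    simp only [H]
    rw [this, ← sub_div, ← Finset.sum_sub_distrib, Finset.sum_div]
    refine Finset.sum_congr rfl fun η _ => ?_
    have h1 := Real.mul_self_sqrt (hc U₀ hU₀ a j η)
    have h2 := Real.mul_self_sqrt (hc U₁ hU₁ a j η)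
    linear_combination h1 / 2 + h2 / 2
  have hHω : ∀ a j, H a j ≤ ω a j := fun a j => by
    rw [← sub_nonneg, ← hbc]; positivity
  have h1 : ∀ a : I → J, ∑ ξ : I → X, √(mixLik π U₀ a ξ) * √(mixLik π U₁ a ξ) =
      ∏ j, (ω a j - H a j) := by
    intro a
    have : ∀ ξ : I → X, √(mixLik π U₀ a ξ) * √(mixLik π U₁ a ξ) =
        ∏ j, √(cellLik π (fun (i : {i // a i = j}) => U₀ j i) (fun i => ξ i)) *
          √(cellLik π (fun (i : {i // a i = j}) => U₁ j i) (fun i => ξ i)) := by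
      intro ξ
      rw [mixLik_eq_prod, mixLik_eq_prod, Finset.prod_mul_distrib,
        Real.sqrt_prod _ fun j _ => hc U₀ hU₀ a j _, Real.sqrt_prod _ fun j _ => hc U₁ hU₁ a j _]
    simp_rw [this]
    rw [sum_prod_fiber a fun j η => √(cellLik π (fun (i : {i // a i = j}) => U₀ j i) η) *
          √(cellLik π (fun (i : {i // a i = j}) => U₁ j i) η)]
    exact Finset.prod_congr rfl fun j _ => hbc a j
  have h2 : ∀ a j, j ∉ Finset.univ.erase j₀ → H a j = 0 := by
    intro a j hj
    have : j = j₀ := by simpa using hj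
    subst this
    simp [H, hU]
  have h3 : Z - ∑ a, ∏ j, (ω a j - H a j) ≤
      ∑ b ∈ Finset.univ.erase j₀, ∑ a, h (Fintype.card {i // a i = b}) *
        ∏ j ∈ Finset.univ.erase b, ω a j := by
    rw [← hZ', ← Finset.sum_sub_distrib, Finset.sum_comm (s := Finset.univ.erase j₀)]
    refine Finset.sum_le_sum fun a _ => ?_
    have := prod_sub_sum_le_prod_sub Finset.univ (ω a) (H a) (hH0 a) (hHω a)
    rw [← Finset.sum_subset (Finset.subset_univ (Finset.univ.erase j₀))
      fun j _ hj => by rw [h2 a j hj, zero_mul]] at this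
    have h4 : ∑ j ∈ Finset.univ.erase j₀, H a j * ∏ l ∈ Finset.univ.erase j, ω a l ≤
        ∑ b ∈ Finset.univ.erase j₀, h (Fintype.card {i // a i = b}) *
        ∏ j ∈ Finset.univ.erase b, ω a j := by
      refine Finset.sum_le_sum fun j hj => mul_le_mul_of_nonneg_right ?_
        (Finset.prod_nonneg fun l _ => (hH0 a l).trans (hHω a l))
      have := hH a j (Finset.ne_of_mem_erase hj)
      simp only [H]
      linarith
    have h5 : ∏ j, ω a j = ∏ j, ∑ φ, π φ * α j φ ^ Fintype.card {i // a i = j} := rfl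
    linarith
  simp_rw [h1]
  refine h3.trans ?_
  calc _ ≤ ∑ b ∈ Finset.univ.erase j₀, Z * S := Finset.sum_le_sum fun b _ =>
        sum_cell_mul_prod_erase_le π α hπ hπ1 hα τ hτ j₀ hj₀ h hh b
    _ = _ := by rw [Finset.sum_const, nsmul_eq_mul]; ring

end Mixture

/-- Uniform density on the window `[c, c + L)`. -/
noncomputable def winK (L c x : ℕ) : ℝ := if c ≤ x ∧ x < c + L then (L : ℝ)⁻¹ else 0

/-- Half sum of the uniform densities on the windows right and left of `c`. -/
noncomputable def avgK (L c x : ℕ) : ℝ := (winK L c x + winK L (c - L) x) / 2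

/-- Half difference of the uniform densities on the windows right and left of `c`. -/
noncomputable def difK (L c x : ℕ) : ℝ := (winK L c x - winK L (c - L) x) / 2

theorem winK_nonneg (L c x : ℕ) : 0 ≤ winK L c x := by
  unfold winK; split_ifs <;> positivity

theorem abs_difK_le (L c x : ℕ) : |difK L c x| ≤ avgK L c x := by
  have h1 := winK_nonneg L c x
  have h2 := winK_nonneg L (c - L) x
  unfold difK avgK
  rw [abs_le]; constructor <;> linarith

theorem avgK_nonneg (L c x : ℕ) : 0 ≤ avgK L c x := (abs_nonneg _).trans (abs_difK_le L c x)

theorem sum_Ico_indicator_le (N a b : ℕ) :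
    ∑ x ∈ Finset.range N, (if a ≤ x ∧ x < b then (1 : ℝ) else 0) ≤ (b - a : ℕ) := by
  rw [Finset.sum_boole]
  norm_cast
  rw [← Nat.card_Ico]
  exact Finset.card_le_card fun x hx => by simpa using (Finset.mem_filter.1 hx).2

theorem sum_winK_le_one (N L c : ℕ) : ∑ x ∈ Finset.range N, winK L c x ≤ 1 := by
  rcases Nat.eq_zero_or_pos L with rfl | hL
  · simp [winK]
  have h := sum_Ico_indicator_le N c (c + L)
  have e : ∀ x, winK L c x = (L : ℝ)⁻¹ * if c ≤ x ∧ x < c + L then (1 : ℝ) else 0 := fun x => by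
    simp [winK]
  simp_rw [e, ← Finset.mul_sum]
  rw [Nat.add_sub_cancel_left] at h
  rw [inv_mul_le_iff₀ (by positivity)]
  simpa using h

theorem sum_winK {N L c : ℕ} (hL : 0 < L) (h : c + L ≤ N) :
    ∑ x ∈ Finset.range N, winK L c x = 1 := by
  unfold winK
  rw [← Finset.sum_filter, Finset.sum_const]
  have : (Finset.range N).filter (fun x => c ≤ x ∧ x < c + L) = Finset.Ico c (c + L) := by
    ext x; simp only [Finset.mem_filter, Finset.mem_range, Finset.mem_Ico]; omega
  rw [this, Nat.card_Ico, Nat.add_sub_cancel_left, nsmul_eq_mul]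
  have : (L : ℝ) ≠ 0 := by positivity
  field_simp

theorem sum_avgK_le_one (N L c : ℕ) : ∑ x ∈ Finset.range N, avgK L c x ≤ 1 := by
  unfold avgK
  rw [← Finset.sum_div, Finset.sum_add_distrib]
  linarith [sum_winK_le_one N L c, sum_winK_le_one N L (c - L)]

theorem sum_avgK {N L c : ℕ} (hL : 0 < L) (h : c + L ≤ N) :
    ∑ x ∈ Finset.range N, avgK L c x = 1 := by
  unfold avgK
  rw [← Finset.sum_div, Finset.sum_add_distrib, sum_winK hL h, sum_winK hL (by omega)]
  norm_num

theorem sum_abs_difK_le_one (N L c : ℕ) : ∑ x ∈ Finset.range N, |difK L c x| ≤ 1 :=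
  (Finset.sum_le_sum fun x _ => abs_difK_le L c x).trans (sum_avgK_le_one N L c)

theorem sum_abs_winK_sub_le {N L c c' e : ℕ} (h : c ≤ c' + e) (h' : c' ≤ c + e) :
    ∑ x ∈ Finset.range N, |winK L c x - winK L c' x| ≤ 2 * e / L := by
  wlog hc : c ≤ c' generalizing c c'
  · simp_rw [abs_sub_comm (winK L c _)]
    exact this h' h (by omega)
  have hp : ∀ x, |winK L c x - winK L c' x| ≤ (L : ℝ)⁻¹ *
      ((if c ≤ x ∧ x < c' then (1 : ℝ) else 0) +
        if c + L ≤ x ∧ x < c' + L then (1 : ℝ) else 0) := by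
    intro x
    have hL : (0 : ℝ) ≤ (L : ℝ)⁻¹ := by positivity
    unfold winK
    split_ifs <;> first | omega | simp [abs_of_nonneg hL]
  calc _ ≤ _ := Finset.sum_le_sum fun x _ => hp x
    _ = (L : ℝ)⁻¹ * (∑ x ∈ Finset.range N, (if c ≤ x ∧ x < c' then (1 : ℝ) else 0) +
        ∑ x ∈ Finset.range N, if c + L ≤ x ∧ x < c' + L then (1 : ℝ) else 0) := by
      rw [← Finset.mul_sum, Finset.sum_add_distrib]
    _ ≤ (L : ℝ)⁻¹ * ((c' - c : ℕ) + (c' + L - (c + L) : ℕ)) := by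
      gcongr
      · exact sum_Ico_indicator_le _ _ _
      · exact sum_Ico_indicator_le _ _ _
    _ ≤ (L : ℝ)⁻¹ * (e + e) := by
      gcongr <;> omega
    _ = _ := by ring

theorem sum_abs_difK_sub_le {N L c c' e : ℕ} (h : c ≤ c' + e) (h' : c' ≤ c + e) :
    ∑ x ∈ Finset.range N, |difK L c x - difK L c' x| ≤ 2 * e / L := by
  have h1 := sum_abs_winK_sub_le (N := N) (L := L) h h'
  have h2 := sum_abs_winK_sub_le (N := N) (L := L) (c := c - L) (c' := c' - L) (e := e)
    (by omega) (by omega)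
  have : ∀ x, |difK L c x - difK L c' x| ≤
      (|winK L c x - winK L c' x| + |winK L (c - L) x - winK L (c' - L) x|) / 2 := by
    intro x
    have := abs_sub (winK L c x - winK L c' x) (winK L (c - L) x - winK L (c' - L) x)
    have e : difK L c x - difK L c' x =
      ((winK L c x - winK L c' x) - (winK L (c - L) x - winK L (c' - L) x)) / 2 := by
      unfold difK; ring
    rw [e, abs_div, abs_two]
    linarith
  refine (Finset.sum_le_sum fun x _ => this x).trans ?_
  rw [← Finset.sum_div, Finset.sum_add_distrib]
  linarith

theorem sum_abs_avgK_sub_le {N L c c' e : ℕ} (h : c ≤ c' + e) (h' : c' ≤ c + e) :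
    ∑ x ∈ Finset.range N, |avgK L c x - avgK L c' x| ≤ 2 * e / L := by
  have h1 := sum_abs_winK_sub_le (N := N) (L := L) h h'
  have h2 := sum_abs_winK_sub_le (N := N) (L := L) (c := c - L) (c' := c' - L) (e := e)
    (by omega) (by omega)
  have : ∀ x, |avgK L c x - avgK L c' x| ≤
      (|winK L c x - winK L c' x| + |winK L (c - L) x - winK L (c' - L) x|) / 2 := by
    intro x
    have := abs_add_le (winK L c x - winK L c' x) (winK L (c - L) x - winK L (c' - L) x)
    have e : avgK L c x - avgK L c' x =
      ((winK L c x - winK L c' x) + (winK L (c - L) x - winK L (c' - L) x)) / 2 := by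
      unfold avgK; ring
    rw [e, abs_div, abs_two]
    linarith
  refine (Finset.sum_le_sum fun x _ => this x).trans ?_
  rw [← Finset.sum_div, Finset.sum_add_distrib]
  linarith

theorem near_of_difK_ne_zero {L c x : ℕ} (h : difK L c x ≠ 0) : c ≤ x + L ∧ x ≤ c + L := by
  by_contra hn
  apply h
  unfold difK winK
  rw [if_neg (by omega), if_neg (by omega)]
  simp

theorem sum_abs_sum_difK_le {N M L : ℕ} (hLM : L ≤ M) :
    ∑ x ∈ Finset.range N, |∑ A ∈ Finset.range M, difK L (M + A) x| ≤ L := by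
  have e : ∀ x, ∑ A ∈ Finset.range M, difK L (M + A) x =
      (∑ i ∈ Finset.range L, (winK L (M - L + (M + i)) x - winK L (M - L + i) x)) / 2 := by
    intro x
    unfold difK
    rw [← Finset.sum_div, Finset.sum_sub_distrib, Finset.sum_sub_distrib]
    have h1 := Finset.sum_range_add (fun i => winK L (M - L + i) x) M L
    have h2 := Finset.sum_range_add (fun i => winK L (M - L + i) x) L M
    rw [add_comm L M, h1] at h2
    have h3 : ∀ i, M - L + (L + i) = M + i := fun i => by omega
    have h4 : ∀ i, M + i - L = M - L + i := fun i => by omega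
    simp_rw [h3] at h2
    simp_rw [h4]
    linarith
  simp_rw [e, abs_div, abs_two]
  rw [← Finset.sum_div, div_le_iff₀ two_pos]
  calc _ ≤ ∑ x ∈ Finset.range N, ∑ i ∈ Finset.range L,
        (winK L (M - L + (M + i)) x + winK L (M - L + i) x) := by
        refine Finset.sum_le_sum fun x _ => (Finset.abs_sum_le_sum_abs _ _).trans
          (Finset.sum_le_sum fun i _ => ?_)
        have h1 := winK_nonneg L (M - L + (M + i)) x
        have h2 := winK_nonneg L (M - L + i) x
        rw [abs_le]; constructor <;> linarith
    _ = ∑ i ∈ Finset.range L, (∑ x ∈ Finset.range N, winK L (M - L + (M + i)) x +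
        ∑ x ∈ Finset.range N, winK L (M - L + i) x) := by
        rw [Finset.sum_comm]; simp_rw [Finset.sum_add_distrib]
    _ ≤ ∑ i ∈ Finset.range L, (1 + 1 : ℝ) := Finset.sum_le_sum fun i _ =>
        add_le_add (sum_winK_le_one _ _ _) (sum_winK_le_one _ _ _)
    _ = _ := by simp; ring

theorem sum_abs_sum_mul_mul_le {A X Y Z : Type*} [Fintype A] [Fintype X] [Fintype Y] [Fintype Z]
    (P : A → X → ℝ) (Q : A → Y → ℝ) (R : A → Z → ℝ) (Q' : X → Y → ℝ) (R' : X → Z → ℝ)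
    {e t : ℝ} (hP : ∀ a, ∑ x, |P a x| ≤ 1) (hR : ∀ a, ∑ z, |R a z| ≤ 1)
    (hQ' : ∀ x, ∑ y, |Q' x y| ≤ 1) (hR' : ∀ x, ∑ z, |R' x z| ≤ 1) (he : 0 ≤ e)
    (hQQ : ∀ a x, P a x ≠ 0 → ∑ y, |Q a y - Q' x y| ≤ e)
    (hRR : ∀ a x, P a x ≠ 0 → ∑ z, |R a z - R' x z| ≤ e) (ht : ∑ x, |∑ a, P a x| ≤ t) :
    ∑ x, ∑ y, ∑ z, |∑ a, P a x * Q a y * R a z| ≤ Fintype.card A * (2 * e) + t := by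
  have h1 : ∀ x y z, |∑ a, P a x * Q a y * R a z| ≤
      ∑ a, |P a x| * (|Q a y - Q' x y| * |R a z| + |Q' x y| * |R a z - R' x z|) +
        |∑ a, P a x| * (|Q' x y| * |R' x z|) := by
    intro x y z
    have : ∑ a, P a x * Q a y * R a z =
        ∑ a, P a x * ((Q a y - Q' x y) * R a z + Q' x y * (R a z - R' x z)) +
        (∑ a, P a x) * (Q' x y * R' x z) := by
      rw [Finset.sum_mul, ← Finset.sum_add_distrib]
      exact Finset.sum_congr rfl fun a _ => by ring
    rw [this]
    refine (abs_add_le _ _).trans (add_le_add ((Finset.abs_sum_le_sum_abs _ _).trans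
      (Finset.sum_le_sum fun a _ => ?_)) (by rw [abs_mul, abs_mul]))
    rw [abs_mul, ← abs_mul (Q a y - _), ← abs_mul (Q' x y)]
    exact mul_le_mul_of_nonneg_left (abs_add_le _ _) (abs_nonneg _)
  have h2 : ∀ x, ∑ y, ∑ z, |∑ a, P a x * Q a y * R a z| ≤
      ∑ a, |P a x| * (2 * e) + |∑ a, P a x| := by
    intro x
    calc _ ≤ ∑ y, ∑ z,
        (∑ a, |P a x| * (|Q a y - Q' x y| * |R a z| + |Q' x y| * |R a z - R' x z|) +
          |∑ a, P a x| * (|Q' x y| * |R' x z|)) :=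
          Finset.sum_le_sum fun y _ => Finset.sum_le_sum fun z _ => h1 x y z
      _ = ∑ a, |P a x| * ((∑ y, |Q a y - Q' x y|) * (∑ z, |R a z|) +
            (∑ y, |Q' x y|) * (∑ z, |R a z - R' x z|)) +
          |∑ a, P a x| * ((∑ y, |Q' x y|) * ∑ z, |R' x z|) := by
        simp_rw [Finset.sum_add_distrib]
        congr 1
        · simp_rw [Finset.sum_mul_sum, ← Finset.sum_add_distrib, Finset.mul_sum]
          conv_rhs => rw [Finset.sum_comm]
          refine Finset.sum_congr rfl fun y _ => ?_
          rw [Finset.sum_comm]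
        · simp_rw [Finset.sum_mul_sum, Finset.mul_sum]
      _ ≤ _ := by
        refine add_le_add (Finset.sum_le_sum fun a _ => ?_) ?_
        · rcases eq_or_ne (P a x) 0 with h0 | h0
          · simp [h0]
          refine mul_le_mul_of_nonneg_left ?_ (abs_nonneg _)
          have a1 : (∑ y, |Q a y - Q' x y|) * (∑ z, |R a z|) ≤ e * 1 :=
            mul_le_mul (hQQ a x h0) (hR a) (Finset.sum_nonneg fun _ _ => abs_nonneg _) he
          have a2 : (∑ y, |Q' x y|) * (∑ z, |R a z - R' x z|) ≤ 1 * e :=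
            mul_le_mul (hQ' x) (hRR a x h0) (Finset.sum_nonneg fun _ _ => abs_nonneg _) zero_le_one
          linarith
        · have a3 : (∑ y, |Q' x y|) * ∑ z, |R' x z| ≤ 1 * 1 :=
            mul_le_mul (hQ' x) (hR' x) (Finset.sum_nonneg fun _ _ => abs_nonneg _) zero_le_one
          nlinarith [abs_nonneg (∑ a, P a x)]
  calc _ ≤ ∑ x, (∑ a, |P a x| * (2 * e) + |∑ a, P a x|) := Finset.sum_le_sum fun x _ => h2 x
    _ = ∑ a, (∑ x, |P a x|) * (2 * e) + ∑ x, |∑ a, P a x| := by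
      rw [Finset.sum_add_distrib, Finset.sum_comm]
      simp_rw [Finset.sum_mul]
    _ ≤ ∑ a : A, 1 * (2 * e) + t :=
      add_le_add (Finset.sum_le_sum fun a _ => mul_le_mul_of_nonneg_right (hP a) (by positivity)) ht
    _ = _ := by simp

theorem sum_abs_sum_mul_mul_le_card {A X Y Z : Type*} [Fintype A] [Fintype X] [Fintype Y]
    [Fintype Z] (P : A → X → ℝ) (Q : A → Y → ℝ) (R : A → Z → ℝ) (hP : ∀ a, ∑ x, |P a x| ≤ 1)
    (hQ : ∀ a, ∑ y, |Q a y| ≤ 1) (hR : ∀ a, ∑ z, |R a z| ≤ 1) :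
    ∑ x, ∑ y, ∑ z, |∑ a, P a x * Q a y * R a z| ≤ Fintype.card A := by
  calc _ ≤ ∑ x, ∑ y, ∑ z, ∑ a, |P a x| * |Q a y| * |R a z| :=
        Finset.sum_le_sum fun x _ => Finset.sum_le_sum fun y _ => Finset.sum_le_sum fun z _ =>
          (Finset.abs_sum_le_sum_abs _ _).trans
            (Finset.sum_le_sum fun a _ => by rw [abs_mul, abs_mul])
    _ = ∑ a, (∑ x, |P a x|) * (∑ y, |Q a y|) * (∑ z, |R a z|) := by
      have c1 : ∀ x y, ∑ z, ∑ a, |P a x| * |Q a y| * |R a z| =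
          ∑ a, ∑ z, |P a x| * |Q a y| * |R a z| := fun x y => Finset.sum_comm
      have c2 : ∀ x, ∑ y, ∑ a, ∑ z, |P a x| * |Q a y| * |R a z| =
          ∑ a, ∑ y, ∑ z, |P a x| * |Q a y| * |R a z| := fun x => Finset.sum_comm
      simp_rw [c1, c2]
      rw [Finset.sum_comm]
      simp_rw [← Finset.mul_sum, ← Finset.sum_mul, ← Finset.mul_sum, ← Finset.sum_mul]
    _ ≤ ∑ a : A, 1 := by
      refine Finset.sum_le_sum fun a _ => ?_
      have h1 : (∑ x, |P a x|) * (∑ y, |Q a y|) ≤ 1 :=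
        mul_le_one₀ (hP a) (Finset.sum_nonneg fun _ _ => abs_nonneg _) (hQ a)
      exact mul_le_one₀ h1 (Finset.sum_nonneg fun _ _ => abs_nonneg _) (hR a)
    _ = _ := by simp

/-- The `L¹` norm of a three-fold product of kernels averaged over the centre. -/
noncomputable def tripleNorm (B n u v w : ℕ) : ℝ :=
  ∑ x : Fin (3 * B ^ n), ∑ y : Fin (3 * B ^ n), ∑ z : Fin (3 * B ^ n),
    |∑ A : Fin (B ^ n), difK (B ^ u) (B ^ n + A) x * difK (B ^ v) (B ^ n + A) y *
      avgK (B ^ w) (B ^ n + A) z|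

theorem tripleNorm_nonneg (B n u v w : ℕ) : 0 ≤ tripleNorm B n u v w := by
  unfold tripleNorm; positivity

theorem sum_fin_abs_difK_le_one (N L c : ℕ) : ∑ x : Fin N, |difK L c x| ≤ 1 := by
  rw [← Finset.sum_range fun x => |difK L c x|]; exact sum_abs_difK_le_one N L c

theorem sum_fin_abs_avgK_le_one (N L c : ℕ) : ∑ x : Fin N, |avgK L c x| ≤ 1 := by
  simp_rw [abs_of_nonneg (avgK_nonneg L c _)]
  rw [← Finset.sum_range fun x => avgK L c x]; exact sum_avgK_le_one N L c

theorem tripleNorm_le (B n u v w : ℕ) : tripleNorm B n u v w ≤ (B : ℝ) ^ n := by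
  refine (sum_abs_sum_mul_mul_le_card (fun (A : Fin (B ^ n)) (x : Fin (3 * B ^ n)) =>
    difK (B ^ u) (B ^ n + A) x) (fun A (y : Fin (3 * B ^ n)) => difK (B ^ v) (B ^ n + A) y)
    (fun A (z : Fin (3 * B ^ n)) => avgK (B ^ w) (B ^ n + A) z)
    (fun _ => sum_fin_abs_difK_le_one _ _ _) (fun _ => sum_fin_abs_difK_le_one _ _ _)
    (fun _ => sum_fin_abs_avgK_le_one _ _ _)).trans ?_
  simp

theorem tripleNorm_comm (B n u v w : ℕ) : tripleNorm B n u v w = tripleNorm B n v u w := by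
  unfold tripleNorm
  rw [Finset.sum_comm]
  simp_rw [mul_comm (difK (B ^ u) _ _)]

theorem pow_div_pow_le {B u v : ℕ} (hB : 0 < B) (huv : u < v) :
    (B : ℝ) ^ u / (B : ℝ) ^ v ≤ 1 / B := by
  have hB' : (1 : ℝ) ≤ B := by exact_mod_cast hB
  rw [div_le_div_iff₀ (by positivity) (by positivity), one_mul, ← pow_succ]
  exact pow_le_pow_right₀ hB' huv

theorem tripleNorm_le_of_lt {B n u v w : ℕ} (hB : 0 < B) (hun : u < n) (huv : u < v)
    (huw : u < w) : tripleNorm B n u v w ≤ (B : ℝ) ^ n * (5 / B) := by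
  have hB' : (0 : ℝ) < B := by exact_mod_cast hB
  have key := sum_abs_sum_mul_mul_le (fun (A : Fin (B ^ n)) (x : Fin (3 * B ^ n)) =>
    difK (B ^ u) (B ^ n + A) x) (fun A (y : Fin (3 * B ^ n)) => difK (B ^ v) (B ^ n + A) y)
    (fun A (z : Fin (3 * B ^ n)) => avgK (B ^ w) (B ^ n + A) z)
    (fun x y => difK (B ^ v) x y) (fun x z => avgK (B ^ w) x z) (e := 2 / B) (t := (B : ℝ) ^ u)
    (fun _ => sum_fin_abs_difK_le_one _ _ _) (fun _ => sum_fin_abs_avgK_le_one _ _ _)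
    (fun _ => sum_fin_abs_difK_le_one _ _ _) (fun _ => sum_fin_abs_avgK_le_one _ _ _)
    (by positivity) ?_ ?_ ?_
  · refine key.trans ?_
    have h1 : (B : ℝ) ^ u ≤ (B : ℝ) ^ n * (1 / B) := by
      have := pow_div_pow_le hB hun
      rwa [div_le_iff₀ (by positivity), mul_comm] at this
    rw [Fintype.card_fin, Nat.cast_pow]
    calc _ ≤ (B : ℝ) ^ n * (2 * (2 / B)) + (B : ℝ) ^ n * (1 / B) := by gcongr
      _ = _ := by ring
  · intro A x hx
    obtain ⟨h1, h2⟩ := near_of_difK_ne_zero hx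
    have h := sum_abs_difK_sub_le (N := 3 * B ^ n) (L := B ^ v) h1 h2
    rw [Finset.sum_range] at h
    refine h.trans ?_
    have := pow_div_pow_le hB huv
    rw [Nat.cast_pow, Nat.cast_pow, mul_div_assoc]
    calc _ ≤ 2 * (1 / (B : ℝ)) := by gcongr
      _ = _ := by ring
  · intro A x hx
    obtain ⟨h1, h2⟩ := near_of_difK_ne_zero hx
    have h := sum_abs_avgK_sub_le (N := 3 * B ^ n) (L := B ^ w) h1 h2
    rw [Finset.sum_range] at h
    refine h.trans ?_
    have := pow_div_pow_le hB huw
    rw [Nat.cast_pow, Nat.cast_pow, mul_div_assoc]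
    calc _ ≤ 2 * (1 / (B : ℝ)) := by gcongr
      _ = _ := by ring
  · have h := sum_abs_sum_difK_le (N := 3 * B ^ n) (M := B ^ n) (L := B ^ u)
      (Nat.pow_le_pow_right hB hun.le)
    rw [Finset.sum_range] at h
    simp_rw [Finset.sum_range fun A => difK (B ^ u) (B ^ n + A) _] at h
    simpa using h

/-- Of three distinct scales, the smallest one or the largest one belongs to a difference
kernel. -/
theorem tripleNorm_mul_le {B n : ℕ} (hB : 0 < B) (u v w : Fin n) :
    tripleNorm B n u v w * tripleNorm B n u.rev v.rev w.rev ≤ (B : ℝ) ^ n * (B : ℝ) ^ n *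
      ((if u = v then 1 else 0) + (if u = w then 1 else 0) + (if v = w then 1 else 0) + 5 / B) := by
  have hB' : (0 : ℝ) < B := by exact_mod_cast hB
  have h1 := tripleNorm_le B n u v w
  have h2 := tripleNorm_le B n u.rev v.rev w.rev
  have p1 := tripleNorm_nonneg B n u v w
  have p2 := tripleNorm_nonneg B n u.rev v.rev w.rev
  have p3 : (0 : ℝ) ≤ 5 / B := by positivity
  by_cases hd : u = v ∨ u = w ∨ v = w
  · calc _ ≤ (B : ℝ) ^ n * (B : ℝ) ^ n * 1 := by
          rw [mul_one]; exact mul_le_mul h1 h2 p2 (by positivity)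
      _ ≤ _ := by
        refine mul_le_mul_of_nonneg_left ?_ (by positivity)
        rcases hd with h | h | h <;> rw [if_pos h] <;> split_ifs <;> linarith
  · push Not at hd
    obtain ⟨huv, huw, hvw⟩ := hd
    rw [if_neg huv, if_neg huw, if_neg hvw]
    have huv' : (u : ℕ) ≠ v := fun h => huv (Fin.ext h)
    have huw' : (u : ℕ) ≠ w := fun h => huw (Fin.ext h)
    have hvw' : (v : ℕ) ≠ w := fun h => hvw (Fin.ext h)
    have hcase : tripleNorm B n u v w ≤ (B : ℝ) ^ n * (5 / B) ∨
        tripleNorm B n u.rev v.rev w.rev ≤ (B : ℝ) ^ n * (5 / B) := by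
      have := u.2
      have := v.2
      have := w.2
      by_cases a1 : (u : ℕ) < v ∧ (u : ℕ) < w
      · exact .inl (tripleNorm_le_of_lt hB u.2 a1.1 a1.2)
      by_cases a2 : (v : ℕ) < u ∧ (v : ℕ) < w
      · rw [tripleNorm_comm]
        exact .inl (tripleNorm_le_of_lt hB v.2 a2.1 a2.2)
      by_cases a3 : (u.rev : ℕ) < v.rev ∧ (u.rev : ℕ) < w.rev
      · exact .inr (tripleNorm_le_of_lt hB u.rev.2 a3.1 a3.2)
      rw [tripleNorm_comm B n u.rev]
      refine .inr (tripleNorm_le_of_lt hB v.rev.2 ?_ ?_) <;>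
      · simp only [Fin.val_rev] at *
        omega
    rcases hcase with h | h
    · calc _ ≤ ((B : ℝ) ^ n * (5 / B)) * (B : ℝ) ^ n := mul_le_mul h h2 p2 (by positivity)
        _ = _ := by ring
    · calc _ ≤ (B : ℝ) ^ n * ((B : ℝ) ^ n * (5 / B)) := mul_le_mul h1 h p2 (by positivity)
        _ = _ := by ring

theorem sum_tripleNorm_mul_le {B n : ℕ} (hB : 0 < B) :
    ∑ u : Fin n, ∑ v : Fin n, ∑ w : Fin n,
      tripleNorm B n u v w * tripleNorm B n u.rev v.rev w.rev ≤
      (B : ℝ) ^ n * (B : ℝ) ^ n * (3 * n ^ 2 + n ^ 3 * (5 / B)) := by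
  refine (Finset.sum_le_sum fun u _ => Finset.sum_le_sum fun v _ => Finset.sum_le_sum fun w _ =>
    tripleNorm_mul_le hB u v w).trans_eq ?_
  simp_rw [← Finset.mul_sum, Finset.sum_add_distrib]
  congr 1
  simp
  ring

/-- A random density on a sub-grid: an average over scales of products of window kernels around
the centre `θ`, the two coordinates having opposite scales. -/
noncomputable def binDensity (B n : ℕ) (θ : Fin (B ^ n) × Fin (B ^ n))
    (x : Fin (3 * B ^ n) × Fin (3 * B ^ n)) : ℝ :=
  (∑ u : Fin n, avgK (B ^ (u : ℕ)) (B ^ n + θ.1) x.1 *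
    avgK (B ^ (u.rev : ℕ)) (B ^ n + θ.2) x.2) / n

/-- The signed perturbation of `binDensity`, constant in sign on each quadrant around `θ`. -/
noncomputable def binBump (B n : ℕ) (θ : Fin (B ^ n) × Fin (B ^ n))
    (x : Fin (3 * B ^ n) × Fin (3 * B ^ n)) : ℝ :=
  (∑ u : Fin n, difK (B ^ (u : ℕ)) (B ^ n + θ.1) x.1 *
    difK (B ^ (u.rev : ℕ)) (B ^ n + θ.2) x.2) / n

theorem abs_binBump_le (B n : ℕ) (θ : Fin (B ^ n) × Fin (B ^ n))
    (x : Fin (3 * B ^ n) × Fin (3 * B ^ n)) : |binBump B n θ x| ≤ binDensity B n θ x := by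
  unfold binBump binDensity
  rw [abs_div, Nat.abs_cast]
  gcongr
  refine (Finset.abs_sum_le_sum_abs _ _).trans (Finset.sum_le_sum fun u _ => ?_)
  rw [abs_mul]
  exact mul_le_mul (abs_difK_le _ _ _) (abs_difK_le _ _ _) (abs_nonneg _) (avgK_nonneg _ _ _)

theorem sum_binDensity {B n : ℕ} (hB : 0 < B) (hn : 0 < n) (θ : Fin (B ^ n) × Fin (B ^ n)) :
    ∑ x, binDensity B n θ x = 1 := by
  have h : ∀ (u : Fin n) (a : Fin (B ^ n)),
      ∑ x : Fin (3 * B ^ n), avgK (B ^ (u : ℕ)) (B ^ n + a) x = 1 := by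
    intro u a
    rw [← Finset.sum_range fun x => avgK (B ^ (u : ℕ)) (B ^ n + a) x]
    refine sum_avgK (by positivity) ?_
    have := Nat.pow_le_pow_right hB u.2.le
    have := a.2
    omega
  unfold binDensity
  rw [← Finset.sum_div, Finset.sum_comm, div_eq_one_iff_eq (by positivity)]
  simp_rw [Fintype.sum_prod_type, ← Finset.mul_sum, h, mul_one, h]
  simp

theorem sum_difK_lt {N L c : ℕ} (hL : 0 < L) (hLc : L ≤ c) (hc : c ≤ N) :
    ∑ x ∈ Finset.range N, (if x < c then difK L c x else 0) = -1 / 2 := by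
  have e : ∀ x, (if x < c then difK L c x else 0) = -winK L (c - L) x / 2 := by
    intro x
    unfold difK winK
    split_ifs <;> first | omega | simp
    try ring
  simp_rw [e]
  rw [← Finset.sum_div, Finset.sum_neg_distrib, sum_winK hL (by omega)]

theorem sum_binBump_quadrant {B n : ℕ} (hB : 0 < B) (hn : 0 < n)
    (θ : Fin (B ^ n) × Fin (B ^ n)) :
    ∑ x : Fin (3 * B ^ n) × Fin (3 * B ^ n),
      (if (x.1 : ℕ) < B ^ n + θ.1 ∧ (x.2 : ℕ) < B ^ n + θ.2 then binBump B n θ x else 0) =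
        1 / 4 := by
  have h : ∀ (u : Fin n) (a : Fin (B ^ n)), ∑ x : Fin (3 * B ^ n),
      (if (x : ℕ) < B ^ n + a then difK (B ^ (u : ℕ)) (B ^ n + a) x else 0) = -1 / 2 := by
    intro u a
    have := Nat.pow_le_pow_right hB u.2.le
    have := a.2
    rw [← Finset.sum_range fun x : ℕ =>
      if x < B ^ n + a then difK (B ^ (u : ℕ)) (B ^ n + a) x else 0]
    exact sum_difK_lt (by positivity) (by omega) (by omega)
  have e : ∀ x : Fin (3 * B ^ n) × Fin (3 * B ^ n),
      (if (x.1 : ℕ) < B ^ n + θ.1 ∧ (x.2 : ℕ) < B ^ n + θ.2 then binBump B n θ x else 0) =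
      (∑ u : Fin n,
        (if (x.1 : ℕ) < B ^ n + θ.1 then difK (B ^ (u : ℕ)) (B ^ n + θ.1) x.1 else 0) *
        (if (x.2 : ℕ) < B ^ n + θ.2 then difK (B ^ (u.rev : ℕ)) (B ^ n + θ.2) x.2 else 0)) /
          n := by
    intro x
    unfold binBump
    by_cases h1 : (x.1 : ℕ) < B ^ n + θ.1 <;> by_cases h2 : (x.2 : ℕ) < B ^ n + θ.2 <;>
      simp [h1, h2]
  simp_rw [e]
  rw [← Finset.sum_div, Finset.sum_comm]
  simp_rw [Fintype.sum_prod_type, ← Finset.mul_sum, h, ← Finset.sum_mul, h]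
  have : (n : ℝ) ≠ 0 := by positivity
  simp
  field_simp
  norm_num

theorem sum_abs_sum_binBump_le {B n : ℕ} (hB : 0 < B) (hn : 0 < n) :
    ∑ x, ∑ y, ∑ z, |∑ θ, binBump B n θ x * binBump B n θ y * binDensity B n θ z| ≤
      (B : ℝ) ^ n * (B : ℝ) ^ n * (3 / n + 5 / B) := by
  have hn' : (0 : ℝ) < n := by exact_mod_cast hn
  have hsplit : ∀ x y z, |∑ θ, binBump B n θ x * binBump B n θ y * binDensity B n θ z| ≤
      (∑ u : Fin n, ∑ v : Fin n, ∑ w : Fin n,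
        |∑ A : Fin (B ^ n), difK (B ^ (u : ℕ)) (B ^ n + A) x.1 *
          difK (B ^ (v : ℕ)) (B ^ n + A) y.1 * avgK (B ^ (w : ℕ)) (B ^ n + A) z.1| *
        |∑ A : Fin (B ^ n), difK (B ^ (u.rev : ℕ)) (B ^ n + A) x.2 *
          difK (B ^ (v.rev : ℕ)) (B ^ n + A) y.2 *
            avgK (B ^ (w.rev : ℕ)) (B ^ n + A) z.2|) / n ^ 3 := by
    intro x y z
    have : ∑ θ, binBump B n θ x * binBump B n θ y * binDensity B n θ z =
      (∑ u : Fin n, ∑ v : Fin n, ∑ w : Fin n,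
        (∑ A : Fin (B ^ n), difK (B ^ (u : ℕ)) (B ^ n + A) x.1 *
          difK (B ^ (v : ℕ)) (B ^ n + A) y.1 * avgK (B ^ (w : ℕ)) (B ^ n + A) z.1) *
        (∑ A : Fin (B ^ n), difK (B ^ (u.rev : ℕ)) (B ^ n + A) x.2 *
          difK (B ^ (v.rev : ℕ)) (B ^ n + A) y.2 *
            avgK (B ^ (w.rev : ℕ)) (B ^ n + A) z.2)) / n ^ 3 := by
      have e : ∀ θ, binBump B n θ x * binBump B n θ y * binDensity B n θ z =
          (∑ u : Fin n, ∑ v : Fin n, ∑ w : Fin n,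
            (difK (B ^ (u : ℕ)) (B ^ n + θ.1) x.1 *
              difK (B ^ (v : ℕ)) (B ^ n + θ.1) y.1 * avgK (B ^ (w : ℕ)) (B ^ n + θ.1) z.1) *
            (difK (B ^ (u.rev : ℕ)) (B ^ n + θ.2) x.2 *
              difK (B ^ (v.rev : ℕ)) (B ^ n + θ.2) y.2 *
                avgK (B ^ (w.rev : ℕ)) (B ^ n + θ.2) z.2)) / n ^ 3 := by
        intro θ
        unfold binBump binDensity
        rw [div_mul_div_comm, div_mul_div_comm, Finset.sum_mul_sum, Finset.sum_mul,
          show (n : ℝ) * n * n = n ^ 3 by ring]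
        congr 1
        refine Finset.sum_congr rfl fun u _ => ?_
        rw [Finset.sum_mul]
        refine Finset.sum_congr rfl fun v _ => ?_
        rw [Finset.mul_sum]
        exact Finset.sum_congr rfl fun w _ => by ring
      simp_rw [e]
      rw [← Finset.sum_div]
      congr 1
      rw [Finset.sum_comm]
      refine Finset.sum_congr rfl fun u _ => ?_
      rw [Finset.sum_comm]
      refine Finset.sum_congr rfl fun v _ => ?_
      rw [Finset.sum_comm]
      refine Finset.sum_congr rfl fun w _ => ?_
      rw [Finset.sum_mul_sum, Fintype.sum_prod_type]
    rw [this, abs_div, abs_of_pos (a := (n : ℝ) ^ 3) (by positivity)]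
    gcongr
    refine (Finset.abs_sum_le_sum_abs _ _).trans (Finset.sum_le_sum fun u _ => ?_)
    refine (Finset.abs_sum_le_sum_abs _ _).trans (Finset.sum_le_sum fun v _ => ?_)
    refine (Finset.abs_sum_le_sum_abs _ _).trans (Finset.sum_le_sum fun w _ => ?_)
    rw [abs_mul]
  have hfac : ∀ (F G : Fin (3 * B ^ n) → Fin (3 * B ^ n) → Fin (3 * B ^ n) → ℝ),
      ∑ x : Fin (3 * B ^ n) × Fin (3 * B ^ n), ∑ y : Fin (3 * B ^ n) × Fin (3 * B ^ n),
        ∑ z : Fin (3 * B ^ n) × Fin (3 * B ^ n), F x.1 y.1 z.1 * G x.2 y.2 z.2 =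
      (∑ x, ∑ y, ∑ z, F x y z) * ∑ x, ∑ y, ∑ z, G x y z := by
    intro F G
    simp_rw [Fintype.sum_prod_type, ← Finset.mul_sum, ← Finset.sum_mul, ← Finset.mul_sum,
      ← Finset.sum_mul, ← Finset.mul_sum, ← Finset.sum_mul]
  have hcomm : ∀ (H : Fin n → (Fin (3 * B ^ n) × Fin (3 * B ^ n)) →
      (Fin (3 * B ^ n) × Fin (3 * B ^ n)) → (Fin (3 * B ^ n) × Fin (3 * B ^ n)) → ℝ),
      ∑ x, ∑ y, ∑ z, ∑ u, H u x y z = ∑ u, ∑ x, ∑ y, ∑ z, H u x y z := by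
    intro H
    have c1 : ∀ x y, ∑ z, ∑ u, H u x y z = ∑ u, ∑ z, H u x y z := fun x y => Finset.sum_comm
    have c2 : ∀ x, ∑ y, ∑ u, ∑ z, H u x y z = ∑ u, ∑ y, ∑ z, H u x y z :=
      fun x => Finset.sum_comm
    simp_rw [c1, c2]
    rw [Finset.sum_comm]
  calc _ ≤ _ := Finset.sum_le_sum fun x _ => Finset.sum_le_sum fun y _ =>
        Finset.sum_le_sum fun z _ => hsplit x y z
    _ = (∑ u : Fin n, ∑ v : Fin n, ∑ w : Fin n,
      tripleNorm B n u v w * tripleNorm B n u.rev v.rev w.rev) / n ^ 3 := by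
      simp_rw [← Finset.sum_div]
      congr 1
      rw [hcomm]
      refine Finset.sum_congr rfl fun u _ => ?_
      rw [hcomm]
      refine Finset.sum_congr rfl fun v _ => ?_
      rw [hcomm]
      refine Finset.sum_congr rfl fun w _ => ?_
      exact hfac (fun x y z => |∑ A : Fin (B ^ n), difK (B ^ (u : ℕ)) (B ^ n + A) x *
          difK (B ^ (v : ℕ)) (B ^ n + A) y * avgK (B ^ (w : ℕ)) (B ^ n + A) z|)
        (fun x y z => |∑ A : Fin (B ^ n), difK (B ^ (u.rev : ℕ)) (B ^ n + A) x *
          difK (B ^ (v.rev : ℕ)) (B ^ n + A) y * avgK (B ^ (w.rev : ℕ)) (B ^ n + A) z|)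
    _ ≤ (B : ℝ) ^ n * (B : ℝ) ^ n * (3 * n ^ 2 + n ^ 3 * (5 / B)) / n ^ 3 := by
      gcongr
      exact sum_tripleNorm_mul_le hB
    _ = _ := by field_simp

theorem sum_difK {N L c : ℕ} (hL : 0 < L) (hc : c + L ≤ N) :
    ∑ x ∈ Finset.range N, difK L c x = 0 := by
  unfold difK
  rw [← Finset.sum_div, Finset.sum_sub_distrib, sum_winK hL hc, sum_winK hL (by omega)]
  norm_num

theorem sum_binBump {B n : ℕ} (hB : 0 < B) (θ : Fin (B ^ n) × Fin (B ^ n)) :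
    ∑ x, binBump B n θ x = 0 := by
  have h : ∀ (u : Fin n) (a : Fin (B ^ n)),
      ∑ x : Fin (3 * B ^ n), difK (B ^ (u : ℕ)) (B ^ n + a) x = 0 := by
    intro u a
    rw [← Finset.sum_range fun x => difK (B ^ (u : ℕ)) (B ^ n + a) x]
    refine sum_difK (by positivity) ?_
    have := Nat.pow_le_pow_right hB u.2.le
    have := a.2
    omega
  unfold binBump
  rw [← Finset.sum_div, Finset.sum_comm]
  simp_rw [Fintype.sum_prod_type, ← Finset.mul_sum, h]
  simp

/-- Upper bound for the total variation between `s`-point marginals. -/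
def marginalGap (δ : ℝ) (s : ℕ) : ℝ := if s ≤ 1 then 0 else if s ≤ 3 then 3 * δ else 2

theorem marginalGap_nonneg {δ : ℝ} (hδ : 0 ≤ δ) (s : ℕ) : 0 ≤ marginalGap δ s := by
  unfold marginalGap; split_ifs <;> positivity

theorem sum_fin_two_arrow {X : Type*} [Fintype X] (F : (Fin 2 → X) → ℝ) :
    ∑ η, F η = ∑ x, ∑ y, F ![x, y] := by
  rw [← Fintype.sum_prod_type' (f := fun x y => F ![x, y])]
  refine (Fintype.sum_equiv (finTwoArrowEquiv X).symm _ _ fun p => ?_).symm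
  rw [finTwoArrowEquiv_symm_apply]

theorem sum_fin_three_arrow {X : Type*} [Fintype X] (F : (Fin 3 → X) → ℝ) :
    ∑ η, F η = ∑ x, ∑ y, ∑ z, F ![x, y, z] := by
  rw [← (Fin.consEquiv fun _ : Fin 3 => X).sum_comp, Fintype.sum_prod_type]
  refine Finset.sum_congr rfl fun x _ => ?_
  rw [sum_fin_two_arrow]
  rfl

theorem density_add_nonneg {Θ X : Type*} {r f : Θ → X → ℝ} (hf : ∀ θ x, |f θ x| ≤ r θ x) {c : ℝ}
    (hc : |c| ≤ 1) (θ : Θ) (x : X) :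
    0 ≤ r θ x + c * f θ x ∧ 0 ≤ r θ x - c * f θ x ∧ r θ x + c * f θ x ≤ 2 * r θ x ∧
      r θ x - c * f θ x ≤ 2 * r θ x := by
  have h1 : |c * f θ x| ≤ r θ x := by
    rw [abs_mul]
    nlinarith [hf θ x, abs_nonneg (f θ x), abs_nonneg c]
  have := abs_le.1 h1
  refine ⟨?_, ?_, ?_, ?_⟩ <;> linarith

section Gap

variable {Θ X : Type*} [Fintype Θ] (ρ : Θ → ℝ) (r f : Θ → X → ℝ)

/-- Difference between the marginals with and without signed perturbation. -/
noncomputable def gap {ι : Type*} [Fintype ι] (c : ι → ℝ) (η : ι → X) : ℝ :=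
  ∑ θ, ρ θ * ((∏ i, (r θ (η i) + c i * f θ (η i)) + ∏ i, (r θ (η i) - c i * f θ (η i))) / 2 -
    ∏ i, r θ (η i))

variable {ρ r f} (hρ : ∀ θ, 0 ≤ ρ θ) (hρ1 : ∑ θ, ρ θ = 1) (hf : ∀ θ x, |f θ x| ≤ r θ x)

include hρ hf in
theorem abs_gap_le {ι : Type*} [Fintype ι] (c : ι → ℝ) (hc : ∀ i, |c i| ≤ 1) (η : ι → X) :
    |gap ρ r f c η| ≤ 2 ^ Fintype.card ι * ∑ θ, ρ θ * ∏ i, r θ (η i) := by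
  unfold gap
  rw [Finset.mul_sum]
  refine (Finset.abs_sum_le_sum_abs _ _).trans (Finset.sum_le_sum fun θ _ => ?_)
  rw [abs_mul, abs_of_nonneg (hρ θ), mul_left_comm]
  refine mul_le_mul_of_nonneg_left ?_ (hρ θ)
  have h := fun i => density_add_nonneg hf (hc i) θ (η i)
  have hr0 : ∀ x, 0 ≤ r θ x := fun x => (abs_nonneg _).trans (hf θ x)
  have e : ∏ i, (2 * r θ (η i)) = 2 ^ Fintype.card ι * ∏ i, r θ (η i) := by
    rw [Finset.prod_mul_distrib]; simp
  have h1 : ∏ i, (r θ (η i) + c i * f θ (η i)) ≤ ∏ i, (2 * r θ (η i)) :=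
    Finset.prod_le_prod (fun i _ => (h i).1) fun i _ => (h i).2.2.1
  have h2 : ∏ i, (r θ (η i) - c i * f θ (η i)) ≤ ∏ i, (2 * r θ (η i)) :=
    Finset.prod_le_prod (fun i _ => (h i).2.1) fun i _ => (h i).2.2.2
  have h3 : 0 ≤ ∏ i, (r θ (η i) + c i * f θ (η i)) := Finset.prod_nonneg fun i _ => (h i).1
  have h4 : 0 ≤ ∏ i, (r θ (η i) - c i * f θ (η i)) := Finset.prod_nonneg fun i _ => (h i).2.1
  have h5 : 0 ≤ ∏ i, r θ (η i) := Finset.prod_nonneg fun i _ => hr0 _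
  have h6 : (1 : ℝ) ≤ 2 ^ Fintype.card ι := one_le_pow₀ one_le_two
  rw [abs_le]
  constructor <;> nlinarith

theorem gap_comp_equiv {ι ι' : Type*} [Fintype ι] [Fintype ι'] (e : ι' ≃ ι) (c : ι → ℝ)
    (η : ι → X) : gap ρ r f c η = gap ρ r f (fun i => c (e i)) fun i => η (e i) := by
  unfold gap
  refine Finset.sum_congr rfl fun θ _ => ?_
  rw [← e.prod_comp, ← e.prod_comp, ← e.prod_comp]

variable [Fintype X] (hr : ∀ θ, ∑ x, r θ x = 1) (hf0 : ∀ θ, ∑ x, f θ x = 0)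

include hρ hρ1 hf hr hf0 in
theorem sum_abs_gap_le_two {ι : Type*} [Fintype ι] [DecidableEq ι] (c : ι → ℝ)
    (hc : ∀ i, |c i| ≤ 1) : ∑ η, |gap ρ r f c η| ≤ 2 := by
  have hs : ∀ (d : ι → ℝ) θ, ∑ η : ι → X, ∏ i, (r θ (η i) + d i * f θ (η i)) = 1 := by
    intro d θ
    rw [← Fintype.piFinset_univ,
      ← Finset.prod_univ_sum (fun _ => Finset.univ) (fun i x => r θ x + d i * f θ x)]
    simp [Finset.sum_add_distrib, ← Finset.mul_sum, hr, hf0]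
  calc _ ≤ ∑ η : ι → X, ∑ θ, ρ θ * ((∏ i, (r θ (η i) + c i * f θ (η i)) +
          ∏ i, (r θ (η i) + (-c i) * f θ (η i))) / 2 + ∏ i, (r θ (η i) + 0 * f θ (η i))) := by
        refine Finset.sum_le_sum fun η _ => ?_
        unfold gap
        refine (Finset.abs_sum_le_sum_abs _ _).trans (Finset.sum_le_sum fun θ _ => ?_)
        rw [abs_mul, abs_of_nonneg (hρ θ)]
        refine mul_le_mul_of_nonneg_left ?_ (hρ θ)
        have h := fun i => density_add_nonneg hf (hc i) θ (η i)
        have h3 : 0 ≤ ∏ i, (r θ (η i) + c i * f θ (η i)) := Finset.prod_nonneg fun i _ => (h i).1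
        have h4 : 0 ≤ ∏ i, (r θ (η i) - c i * f θ (η i)) :=
          Finset.prod_nonneg fun i _ => (h i).2.1
        have h5 : 0 ≤ ∏ i, r θ (η i) :=
          Finset.prod_nonneg fun i _ => (abs_nonneg _).trans (hf θ _)
        simp only [neg_mul, ← sub_eq_add_neg, zero_mul, add_zero]
        rw [abs_le]
        constructor <;> linarith
    _ = ∑ θ, ρ θ * ((1 + 1) / 2 + 1) := by
        rw [Finset.sum_comm]
        refine Finset.sum_congr rfl fun θ _ => ?_
        rw [← Finset.mul_sum, Finset.sum_add_distrib, ← Finset.sum_div, Finset.sum_add_distrib,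
          hs, hs (fun i => -c i), hs (fun _ => 0)]
    _ = 2 := by rw [← Finset.sum_mul, hρ1]; norm_num

theorem sum_abs_gap_comp_equiv {ι ι' : Type*} [Fintype ι] [Fintype ι'] [DecidableEq ι]
    [DecidableEq ι'] (e : ι' ≃ ι) (c : ι → ℝ) :
    ∑ η, |gap ρ r f c η| = ∑ η, |gap ρ r f (fun i => c (e i)) η| :=
  Fintype.sum_equiv (e.symm.arrowCongr (Equiv.refl X)) _ _ fun η => by
    rw [gap_comp_equiv e]; rfl

variable {δ : ℝ} (hδ : ∑ x, ∑ y, ∑ z, |∑ θ, ρ θ * (f θ x * f θ y * r θ z)| ≤ δ)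

include hr hδ in
theorem sum_abs_gap_fin_two_le (c : Fin 2 → ℝ) (hc : ∀ i, |c i| ≤ 1) :
    ∑ η, |gap ρ r f c η| ≤ δ := by
  rw [sum_fin_two_arrow]
  refine le_trans (Finset.sum_le_sum fun x _ => Finset.sum_le_sum fun y _ => ?_) hδ
  have h1 : |c 0 * c 1| ≤ 1 := by
    rw [abs_mul]; exact mul_le_one₀ (hc 0) (abs_nonneg _) (hc 1)
  have e : gap ρ r f c ![x, y] = c 0 * c 1 * ∑ z, ∑ θ, ρ θ * (f θ x * f θ y * r θ z) := by
    rw [Finset.sum_comm]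
    simp_rw [← Finset.mul_sum, hr]
    unfold gap
    rw [Finset.mul_sum]
    refine Finset.sum_congr rfl fun θ _ => ?_
    simp [Fin.prod_univ_two]
    ring
  rw [e, abs_mul]
  refine (mul_le_of_le_one_left (abs_nonneg _) h1).trans (Finset.abs_sum_le_sum_abs _ _)

include hδ in
theorem sum_abs_gap_fin_three_le (c : Fin 3 → ℝ) (hc : ∀ i, |c i| ≤ 1) :
    ∑ η, |gap ρ r f c η| ≤ 3 * δ := by
  rw [sum_fin_three_arrow]
  have h1 : ∀ i j, |c i * c j| ≤ 1 := fun i j => by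
    rw [abs_mul]; exact mul_le_one₀ (hc i) (abs_nonneg _) (hc j)
  set G : X → X → X → ℝ := fun x y z => ∑ θ, ρ θ * (f θ x * f θ y * r θ z) with hG
  have e : ∀ x y z, gap ρ r f c ![x, y, z] =
      c 0 * c 1 * G x y z + c 0 * c 2 * G x z y + c 1 * c 2 * G y z x := by
    intro x y z
    simp only [hG]
    unfold gap
    simp_rw [Finset.mul_sum]
    rw [← Finset.sum_add_distrib, ← Finset.sum_add_distrib]
    refine Finset.sum_congr rfl fun θ _ => ?_
    simp [Fin.prod_univ_three]
    ring
  have h2 : ∀ x y z, |gap ρ r f c ![x, y, z]| ≤ |G x y z| + |G x z y| + |G y z x| := by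
    intro x y z
    rw [e]
    refine (abs_add_three _ _ _).trans ?_
    rw [abs_mul _ (G x y z), abs_mul _ (G x z y), abs_mul _ (G y z x)]
    have := mul_le_of_le_one_left (abs_nonneg (G x y z)) (h1 0 1)
    have := mul_le_of_le_one_left (abs_nonneg (G x z y)) (h1 0 2)
    have := mul_le_of_le_one_left (abs_nonneg (G y z x)) (h1 1 2)
    linarith
  calc _ ≤ ∑ x, ∑ y, ∑ z, (|G x y z| + |G x z y| + |G y z x|) := Finset.sum_le_sum fun x _ =>
        Finset.sum_le_sum fun y _ => Finset.sum_le_sum fun z _ => h2 x y z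
    _ = ∑ x, ∑ y, ∑ z, |G x y z| + ∑ x, ∑ y, ∑ z, |G x y z| + ∑ x, ∑ y, ∑ z, |G x y z| := by
      simp_rw [Finset.sum_add_distrib]
      congr 1
      · congr 1
        exact Finset.sum_congr rfl fun x _ => Finset.sum_comm
      · rw [Finset.sum_comm]
        exact Finset.sum_congr rfl fun y _ => Finset.sum_comm
    _ ≤ _ := by linarith

include hρ hρ1 hf hr hf0 hδ in
theorem sum_abs_gap_le {ι : Type*} [Fintype ι] [DecidableEq ι] (c : ι → ℝ)
    (hc : ∀ i, |c i| ≤ 1) : ∑ η, |gap ρ r f c η| ≤ marginalGap δ (Fintype.card ι) := by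
  have hδ0 : 0 ≤ δ := le_trans (by positivity) hδ
  have e := (Fintype.equivFin ι).symm
  rw [sum_abs_gap_comp_equiv e]
  generalize Fintype.card ι = s at e
  have hc' : ∀ i, |(fun i => c (e i)) i| ≤ 1 := fun i => hc _
  unfold marginalGap
  split_ifs with h1 h2
  · refine (Finset.sum_eq_zero fun η _ => ?_).le
    unfold gap
    rw [abs_eq_zero]
    refine Finset.sum_eq_zero fun θ _ => ?_
    interval_cases s <;> simp
  · have h3 : s = 2 ∨ s = 3 := by omega
    rcases h3 with rfl | rfl
    · exact (sum_abs_gap_fin_two_le hr hδ _ hc').trans (by linarith)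
    · exact sum_abs_gap_fin_three_le hδ _ hc'
  · exact sum_abs_gap_le_two hρ hρ1 hf hr hf0 _ hc'

end Gap

section CellModel

variable {Θ X : Type*}

/-- Prior of the parameter of a cell: heavy flag, random sign, centre. -/
noncomputable def cellPrior (γ : ℝ) (ρ : Θ → ℝ) (φ : Bool × Bool × Θ) : ℝ :=
  (if φ.1 then γ else 1 - γ) * (1 / 2 * ρ φ.2.2)

/-- Mass of a cell: `1` if heavy and `β` if light. -/
def cellMass (β : ℝ) (φ : Bool × Bool × Θ) : ℝ := if φ.1 then 1 else β

/-- Density of a cell; only light cells are perturbed. -/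
def cellDensity (β : ℝ) (r f : Θ → X → ℝ) (c : ℝ) (φ : Bool × Bool × Θ) (x : X) : ℝ :=
  if φ.1 then r φ.2.2 x else β * (r φ.2.2 x + c * (if φ.2.1 then 1 else -1) * f φ.2.2 x)

theorem cellPrior_nonneg {γ : ℝ} (hγ0 : 0 ≤ γ) (hγ1 : γ ≤ 1) {ρ : Θ → ℝ} (hρ : ∀ θ, 0 ≤ ρ θ)
    (φ : Bool × Bool × Θ) : 0 ≤ cellPrior γ ρ φ := by
  unfold cellPrior
  have := hρ φ.2.2
  split_ifs
  · positivity
  · exact mul_nonneg (by linarith) (by positivity)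

theorem cellMass_pos {β : ℝ} (hβ : 0 < β) (φ : Bool × Bool × Θ) : 0 < cellMass β φ := by
  unfold cellMass; split_ifs <;> linarith

theorem cellDensity_nonneg {β : ℝ} (hβ : 0 ≤ β) {r f : Θ → X → ℝ} (hf : ∀ θ x, |f θ x| ≤ r θ x)
    {c : ℝ} (hc : |c| ≤ 1) (φ : Bool × Bool × Θ) (x : X) : 0 ≤ cellDensity β r f c φ x := by
  unfold cellDensity
  have h := density_add_nonneg hf hc φ.2.2 x
  split_ifs
  · exact (abs_nonneg _).trans (hf _ _)
  · rw [mul_one]; exact mul_nonneg hβ h.1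
  · refine mul_nonneg hβ ?_
    linarith [h.2.1]

theorem sum_cellDensity [Fintype X] (β : ℝ) {r f : Θ → X → ℝ} (hr : ∀ θ, ∑ x, r θ x = 1)
    (hf0 : ∀ θ, ∑ x, f θ x = 0) (c : ℝ) (φ : Bool × Bool × Θ) :
    ∑ x, cellDensity β r f c φ x = cellMass β φ := by
  unfold cellDensity cellMass
  split_ifs <;> simp [Finset.sum_add_distrib, ← Finset.mul_sum, hr, hf0]

variable [Fintype Θ]

theorem sum_cellPrior (γ : ℝ) {ρ : Θ → ℝ} (hρ1 : ∑ θ, ρ θ = 1) :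
    ∑ φ, cellPrior γ ρ φ = 1 := by
  unfold cellPrior
  simp_rw [Fintype.sum_prod_type, Fintype.sum_bool]
  simp only [if_true, Bool.false_eq_true, if_false, ← Finset.mul_sum, hρ1]
  ring

theorem cellLik_cellDensity {ι : Type*} [Fintype ι] (γ β : ℝ) (ρ : Θ → ℝ) (r f : Θ → X → ℝ)
    (c : ι → ℝ) (η : ι → X) :
    cellLik (cellPrior γ ρ) (fun i => cellDensity β r f (c i)) η =
      γ * ∑ θ, ρ θ * ∏ i, r θ (η i) + (1 - γ) * β ^ Fintype.card ι *
        ∑ θ, ρ θ * ((∏ i, (r θ (η i) + c i * f θ (η i)) +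
          ∏ i, (r θ (η i) - c i * f θ (η i))) / 2) := by
  unfold cellLik cellPrior cellDensity
  simp_rw [Fintype.sum_prod_type, Fintype.sum_bool]
  simp only [if_true, Bool.false_eq_true, if_false, Finset.prod_mul_distrib, Finset.prod_const,
    Finset.card_univ, Finset.mul_sum, ← Finset.sum_add_distrib, mul_one, mul_neg, neg_mul,
    ← sub_eq_add_neg]
  refine Finset.sum_congr rfl fun θ _ => ?_
  ring

theorem sq_sqrt_sub_sqrt_le {a b μ γ K t : ℝ} (ha : 0 ≤ a) (hμ : 0 ≤ μ) (hγ : 0 < γ)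
    (hb : γ * μ ≤ b) (h1 : |a - b| ≤ t) (h2 : |a - b| ≤ K * μ) (hK : 0 ≤ K) :
    (√b - √a) ^ 2 ≤ γ⁻¹ * K * t := by
  have hb0 : 0 ≤ b := (by positivity : 0 ≤ γ * μ).trans hb
  have ht : 0 ≤ t := (abs_nonneg _).trans h1
  rcases hb0.eq_or_lt with h0 | h0
  · have hμ0 : μ = 0 := by nlinarith
    have : a - b = 0 := by rw [← abs_nonpos_iff]; rw [hμ0, mul_zero] at h2; exact h2
    have : a = b := by linarith
    have : 0 ≤ γ⁻¹ * K * t := by positivity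
    simpa [‹a = b›] using this
  · have e1 := Real.mul_self_sqrt ha
    have e2 := Real.mul_self_sqrt hb0
    have s1 := Real.sqrt_nonneg a
    have s2 := Real.sqrt_nonneg b
    have h3 : (√b - √a) ^ 2 * b ≤ |a - b| ^ 2 := by
      have : |a - b| ^ 2 = (√b - √a) ^ 2 * (√b + √a) ^ 2 := by
        rw [sq_abs]
        have : a - b = (√a - √b) * (√b + √a) := by linear_combination -e1 + e2
        rw [this]; ring
      rw [this]
      refine mul_le_mul_of_nonneg_left ?_ (sq_nonneg _)
      nlinarith
    have h4 : |a - b| ^ 2 ≤ t * (K * μ) := by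
      rw [sq]; exact mul_le_mul h1 h2 (abs_nonneg _) ht
    have h5 : t * (K * μ) ≤ γ⁻¹ * K * t * b := by
      calc t * (K * μ) = γ⁻¹ * K * t * (γ * μ) := by field_simp
        _ ≤ _ := mul_le_mul_of_nonneg_left hb (by positivity)
    exact le_of_mul_le_mul_right (h3.trans (h4.trans h5)) h0

theorem sum_sqrt_cellLik_sub_sq_le [Fintype X] {ρ : Θ → ℝ} {r f : Θ → X → ℝ}
    (hρ : ∀ θ, 0 ≤ ρ θ) (hρ1 : ∑ θ, ρ θ = 1) (hf : ∀ θ x, |f θ x| ≤ r θ x)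
    (hr : ∀ θ, ∑ x, r θ x = 1) (hf0 : ∀ θ, ∑ x, f θ x = 0) {δ : ℝ}
    (hδ : ∑ x, ∑ y, ∑ z, |∑ θ, ρ θ * (f θ x * f θ y * r θ z)| ≤ δ) {β γ : ℝ} (hβ : 0 ≤ β)
    (hγ0 : 0 < γ) (hγ1 : γ ≤ 1) {ι : Type*} [Fintype ι] [DecidableEq ι] (c : ι → ℝ)
    (hc : ∀ i, |c i| ≤ 1) :
    ∑ η, (√(cellLik (cellPrior γ ρ) (fun _ : ι => cellDensity β r f 0) η) -
      √(cellLik (cellPrior γ ρ) (fun i => cellDensity β r f (c i)) η)) ^ 2 ≤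
        γ⁻¹ * (2 * β ^ 2) ^ Fintype.card ι * marginalGap δ (Fintype.card ι) := by
  have hr0 : ∀ θ x, 0 ≤ r θ x := fun θ x => (abs_nonneg _).trans (hf θ x)
  set s := Fintype.card ι
  have key : ∀ η, (√(cellLik (cellPrior γ ρ) (fun _ : ι => cellDensity β r f 0) η) -
      √(cellLik (cellPrior γ ρ) (fun i => cellDensity β r f (c i)) η)) ^ 2 ≤
        γ⁻¹ * (2 * β ^ 2) ^ s * |gap ρ r f c η| := by
    intro η
    have hμ : 0 ≤ ∑ θ, ρ θ * ∏ i, r θ (η i) := Finset.sum_nonneg fun θ _ =>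
      mul_nonneg (hρ θ) (Finset.prod_nonneg fun i _ => hr0 _ _)
    set μ := ∑ θ, ρ θ * ∏ i, r θ (η i)
    have h0 : cellLik (cellPrior γ ρ) (fun _ : ι => cellDensity β r f 0) η =
        γ * μ + (1 - γ) * β ^ s * μ := by
      rw [cellLik_cellDensity γ β ρ r f (fun _ => 0)]
      simp [μ, s]
    have hβs : 0 ≤ β ^ s := pow_nonneg hβ _
    have hd : cellLik (cellPrior γ ρ) (fun i => cellDensity β r f (c i)) η -
        cellLik (cellPrior γ ρ) (fun _ : ι => cellDensity β r f 0) η =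
          (1 - γ) * β ^ s * gap ρ r f c η := by
      rw [h0, cellLik_cellDensity]
      have : gap ρ r f c η = ∑ θ, ρ θ * ((∏ i, (r θ (η i) + c i * f θ (η i)) +
          ∏ i, (r θ (η i) - c i * f θ (η i))) / 2) - μ := by
        unfold gap
        rw [← Finset.sum_sub_distrib]
        exact Finset.sum_congr rfl fun θ _ => by ring
      rw [this]
      ring
    have h1 : |cellLik (cellPrior γ ρ) (fun i => cellDensity β r f (c i)) η -
        cellLik (cellPrior γ ρ) (fun _ : ι => cellDensity β r f 0) η| ≤
          β ^ s * |gap ρ r f c η| := by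
      rw [hd, abs_mul, abs_mul, abs_of_nonneg hβs, abs_of_nonneg (by linarith : 0 ≤ 1 - γ)]
      refine mul_le_mul_of_nonneg_right ?_ (abs_nonneg _)
      nlinarith
    have h2 := abs_gap_le hρ hf c hc η
    refine (sq_sqrt_sub_sqrt_le (K := (2 * β) ^ s) ?_ hμ hγ0 ?_ h1 ?_ (by positivity)).trans_eq ?_
    · exact Finset.sum_nonneg fun φ _ => mul_nonneg (cellPrior_nonneg hγ0.le hγ1 hρ φ)
        (Finset.prod_nonneg fun i _ => cellDensity_nonneg hβ hf (hc i) _ _)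
    · rw [h0]
      have : 0 ≤ (1 - γ) * β ^ s * μ := mul_nonneg (mul_nonneg (by linarith) hβs) hμ
      linarith
    · refine h1.trans ?_
      rw [mul_pow, mul_comm (2 ^ s), mul_assoc]
      exact mul_le_mul_of_nonneg_left h2 hβs
    · rw [mul_pow, mul_pow, sq, mul_pow]; ring
  refine (Finset.sum_le_sum fun η _ => key η).trans ?_
  rw [← Finset.mul_sum]
  exact mul_le_mul_of_nonneg_left (sum_abs_gap_le hρ hρ1 hf hr hf0 hδ c hc) (by positivity)

end CellModel

section DiscreteMeasure

variable {D E : Type*} [Fintype D] [MeasurableSpace E]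

/-- The finite measure with atoms `pos d` of mass `g d`. -/
noncomputable def atomicMeasure (pos : D → E) (g : D → ℝ) : Measure E :=
  ∑ d, ENNReal.ofReal (g d) • Measure.dirac (pos d)

theorem atomicMeasure_apply (pos : D → E) (g : D → ℝ) {s : Set E} (hs : MeasurableSet s) :
    atomicMeasure pos g s = ∑ d, ENNReal.ofReal (g d) * s.indicator 1 (pos d) := by
  simp [atomicMeasure, Measure.dirac_apply' _ hs]

theorem toReal_atomicMeasure_apply (pos : D → E) {g : D → ℝ} (hg : ∀ d, 0 ≤ g d) {s : Set E}
    (hs : MeasurableSet s) [DecidablePred (· ∈ s)] :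
    (atomicMeasure pos g s).toReal = ∑ d, if pos d ∈ s then g d else 0 := by
  rw [atomicMeasure_apply _ _ hs, ENNReal.toReal_sum]
  · refine Finset.sum_congr rfl fun d _ => ?_
    by_cases h : pos d ∈ s <;> simp [h, hg d]
  · intro d _
    by_cases h : pos d ∈ s <;> simp [h]

theorem isProbabilityMeasure_atomicMeasure (pos : D → E) {g : D → ℝ} (hg : ∀ d, 0 ≤ g d)
    (hg1 : ∑ d, g d = 1) : IsProbabilityMeasure (atomicMeasure pos g) := by
  refine ⟨?_⟩
  rw [atomicMeasure_apply _ _ MeasurableSet.univ]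
  simp only [Set.indicator_univ, Pi.one_apply, mul_one]
  rw [← ENNReal.ofReal_sum_of_nonneg fun d _ => hg d, hg1, ENNReal.ofReal_one]

instance (pos : D → E) (g : D → ℝ) : IsFiniteMeasure (atomicMeasure pos g) := by
  refine ⟨?_⟩
  rw [atomicMeasure_apply _ _ MeasurableSet.univ]
  simp

theorem pi_atomicMeasure {κ : Type*} [Fintype κ] [DecidableEq κ] (pos : D → E) {g : D → ℝ}
    (hg : ∀ d, 0 ≤ g d) :
    (Measure.pi fun _ : κ => atomicMeasure pos g) =
      atomicMeasure (fun (d : κ → D) i => pos (d i)) fun d => ∏ i, g (d i) := by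
  refine Measure.pi_eq fun s hs => ?_
  rw [atomicMeasure_apply _ _ (MeasurableSet.univ_pi hs)]
  simp_rw [atomicMeasure_apply _ _ (hs _)]
  rw [Finset.prod_univ_sum, Fintype.piFinset_univ]
  refine Finset.sum_congr rfl fun d _ => ?_
  rw [Finset.prod_mul_distrib, ENNReal.ofReal_prod_of_nonneg fun i _ => hg _]
  congr 1
  by_cases h : ∀ i, pos (d i) ∈ s i
  · rw [Set.indicator_of_mem (by simpa using h)]
    exact (Finset.prod_eq_one fun i _ => by simp [h i]).symm
  · rw [Set.indicator_of_notMem (by simpa using h)]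
    push Not at h
    obtain ⟨i, hi⟩ := h
    exact (Finset.prod_eq_zero (Finset.mem_univ i) (by simp [hi])).symm

theorem prod_atomicMeasure {D' E' : Type*} [Fintype D'] [MeasurableSpace E'] (pos : D → E)
    (pos' : D' → E') {g : D → ℝ} {g' : D' → ℝ} (hg : ∀ d, 0 ≤ g d) :
    (atomicMeasure pos g).prod (atomicMeasure pos' g') =
      atomicMeasure (fun d : D × D' => (pos d.1, pos' d.2)) fun d => g d.1 * g' d.2 := by
  refine Measure.prod_eq fun s t hs ht => ?_
  rw [atomicMeasure_apply _ _ (hs.prod ht), atomicMeasure_apply _ _ hs,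
    atomicMeasure_apply _ _ ht, Finset.sum_mul_sum, Fintype.sum_prod_type]
  refine Finset.sum_congr rfl fun d _ => Finset.sum_congr rfl fun d' _ => ?_
  rw [ENNReal.ofReal_mul (hg d)]
  by_cases h : pos d ∈ s <;> by_cases h' : pos' d' ∈ t <;> simp [h, h']

theorem integral_atomicMeasure (pos : D → E) {g : D → ℝ} (hg : ∀ d, 0 ≤ g d) {F : E → ℝ}
    (hF : Measurable F) : ∫ x, F x ∂(atomicMeasure pos g) = ∑ d, g d * F (pos d) := by
  unfold atomicMeasure
  have hF' := hF.stronglyMeasurable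
  rw [integral_finsetSum_measure]
  · refine Finset.sum_congr rfl fun d _ => ?_
    rw [integral_smul_measure, integral_dirac' _ _ hF', ENNReal.toReal_ofReal (hg d), smul_eq_mul]
  · intro d _
    refine Integrable.smul_measure ?_ ENNReal.ofReal_ne_top
    exact integrable_dirac' hF' (by simp)

theorem integral_pi_prod_pi_atomicMeasure {m : ℕ} (pos : D → E) {g g' : D → ℝ}
    (hg : ∀ d, 0 ≤ g d) (hg' : ∀ d, 0 ≤ g' d) {F : (Fin m → E) × (Fin m → E) → ℝ}
    (hF : Measurable F) :
    ∫ s, F s ∂((Measure.pi fun _ : Fin m => atomicMeasure pos g).prod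
        (Measure.pi fun _ : Fin m => atomicMeasure pos g')) =
      ∑ d : Fin m → D, ∑ d' : Fin m → D, (∏ i, g (d i)) * (∏ i, g' (d' i)) *
        F (fun i => pos (d i), fun i => pos (d' i)) := by
  classical
  have hp : ∀ d : Fin m → D, 0 ≤ ∏ i, g (d i) := fun d => Finset.prod_nonneg fun i _ => hg _
  have hp' : ∀ d : Fin m → D, 0 ≤ ∏ i, g' (d i) := fun d => Finset.prod_nonneg fun i _ => hg' _
  rw [pi_atomicMeasure pos hg, pi_atomicMeasure pos hg', prod_atomicMeasure _ _ hp,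
    integral_atomicMeasure _ (fun d => mul_nonneg (hp _) (hp' _)) hF, Fintype.sum_prod_type]

end DiscreteMeasure

theorem sum_choose_mul_marginalGap_le {m : ℕ} (hm : 0 < m) {β γ δ : ℝ} (hγ : 0 < γ)
    (hβ : 4 * β ^ 2 ≤ 1) (hδ : 0 ≤ δ) :
    ∑ s ∈ Finset.range (2 * m + 1), ((2 * m).choose s : ℝ) *
      ((1 / (m : ℝ)) ^ s * (γ⁻¹ * (2 * β ^ 2) ^ s * marginalGap δ s / 2)) ≤
        γ⁻¹ * (96 * δ * β ^ 4 + 1024 * β ^ 8) := by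
  have hm' : (0 : ℝ) < m := by exact_mod_cast hm
  have hx : 0 ≤ 4 * β ^ 2 := by positivity
  set x := 4 * β ^ 2 with hxd
  have h1 : ∀ s, ((2 * m).choose s : ℝ) *
      ((1 / (m : ℝ)) ^ s * (γ⁻¹ * (2 * β ^ 2) ^ s * marginalGap δ s / 2)) ≤
        γ⁻¹ * (3 * δ * x ^ 2 + 2 * x ^ 4) * (1 / 2) ^ s := by
    intro s
    have hD := marginalGap_nonneg hδ s
    have h2 : ((2 * m).choose s : ℝ) ≤ (2 * m) ^ s / s.factorial := by
      have := Nat.choose_le_pow_div (α := ℝ) s (2 * m)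
      push_cast at this
      exact this
    have h3 : (2 : ℝ) ^ s ≤ 2 * s.factorial := by
      clear hD h2
      induction s with
      | zero => norm_num
      | succ s ih =>
        rcases Nat.eq_zero_or_pos s with rfl | hs
        · norm_num
        · rw [pow_succ, Nat.factorial_succ, Nat.cast_mul, Nat.cast_succ]
          have : (1 : ℝ) ≤ s := by exact_mod_cast hs
          have : (0 : ℝ) < s.factorial := by exact_mod_cast s.factorial_pos
          nlinarith
    have h4 : x ^ s * marginalGap δ s ≤ 3 * δ * x ^ 2 + 2 * x ^ 4 := by
      have p2 : 0 ≤ x ^ 2 := by positivity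
      have p4 : 0 ≤ x ^ 4 := by positivity
      unfold marginalGap
      split_ifs with a1 a2
      · rw [mul_zero]; positivity
      · have : x ^ s ≤ x ^ 2 := pow_le_pow_of_le_one hx hβ (by omega)
        nlinarith
      · have : x ^ s ≤ x ^ 4 := pow_le_pow_of_le_one hx hβ (by omega)
        nlinarith
    have hf : (0 : ℝ) < s.factorial := by exact_mod_cast s.factorial_pos
    calc _ ≤ ((2 * m) ^ s / s.factorial) *
        ((1 / (m : ℝ)) ^ s * (γ⁻¹ * (2 * β ^ 2) ^ s * marginalGap δ s / 2)) := by
          gcongr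
      _ = γ⁻¹ * (x ^ s * marginalGap δ s) * (1 / (2 * s.factorial)) := by
        rw [hxd, mul_pow, div_pow, one_pow, show (4 : ℝ) * β ^ 2 = 2 * (2 * β ^ 2) by ring,
          mul_pow 2 (2 * β ^ 2)]
        field_simp
      _ ≤ γ⁻¹ * (3 * δ * x ^ 2 + 2 * x ^ 4) * (1 / 2) ^ s := by
        gcongr
        rw [one_div_pow]
        exact one_div_le_one_div_of_le (by positivity) h3
  refine (Finset.sum_le_sum fun s _ => h1 s).trans ?_
  rw [← Finset.mul_sum]
  have h5 : ∑ s ∈ Finset.range (2 * m + 1), ((1 : ℝ) / 2) ^ s ≤ 2 := by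
    have := (summable_geometric_two).sum_le_tsum (Finset.range (2 * m + 1))
      (fun _ _ => by positivity)
    rwa [tsum_geometric_two] at this
  calc _ ≤ γ⁻¹ * (3 * δ * x ^ 2 + 2 * x ^ 4) * 2 := by gcongr
    _ = _ := by rw [hxd]; ring

section Model

variable {K Θ X : Type*}

/-- Mass of a cell, or of the reservoir `none`. -/
def modelMass (τ β : ℝ) : Option K → Bool × Bool × Θ → ℝ
  | none, _ => τ
  | some _, φ => cellMass β φ

/-- Density on a cell, or on the reservoir `none`, which carries a single atom. -/
def modelDensity [DecidableEq X] (τ β : ℝ) (r f : Θ → X → ℝ) (x₀ : X) (c : ℝ) :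
    Option K → Bool × Bool × Θ → X → ℝ
  | none, _, x => if x = x₀ then τ else 0
  | some _, φ, x => cellDensity β r f c φ x

theorem modelMass_nonneg {τ β : ℝ} (hτ : 0 ≤ τ) (hβ : 0 < β) (j : Option K)
    (φ : Bool × Bool × Θ) : 0 ≤ modelMass τ β j φ := by
  cases j with
  | none => exact hτ
  | some b => exact (cellMass_pos hβ φ).le

theorem modelDensity_nonneg [DecidableEq X] {τ β : ℝ} (hτ : 0 ≤ τ) (hβ : 0 ≤ β)
    {r f : Θ → X → ℝ} (hf : ∀ θ x, |f θ x| ≤ r θ x) (x₀ : X) {c : ℝ} (hc : |c| ≤ 1)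
    (j : Option K) (φ : Bool × Bool × Θ) (x : X) : 0 ≤ modelDensity τ β r f x₀ c j φ x := by
  cases j with
  | none => simp only [modelDensity]; split_ifs <;> simp [hτ]
  | some b => exact cellDensity_nonneg hβ hf hc φ x

theorem sum_modelDensity [DecidableEq X] [Fintype X] (τ β : ℝ) {r f : Θ → X → ℝ}
    (hr : ∀ θ, ∑ x, r θ x = 1) (hf0 : ∀ θ, ∑ x, f θ x = 0) (x₀ : X) (c : ℝ) (j : Option K)
    (φ : Bool × Bool × Θ) : ∑ x, modelDensity τ β r f x₀ c j φ x = modelMass τ β j φ := by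
  cases j with
  | none => simp [modelDensity, modelMass]
  | some b => exact sum_cellDensity β hr hf0 c φ

variable [Fintype K] [DecidableEq K] [Fintype Θ]

/-- Normalising constant of the tilted prior for `N` samples. -/
noncomputable def tiltMass (K : Type*) [Fintype K] [DecidableEq K] (N : ℕ) (τ β γ : ℝ)
    (ρ : Θ → ℝ) : ℝ :=
  ∑ ϑ : Option K → Bool × Bool × Θ, (∏ j, cellPrior γ ρ (ϑ j)) *
    (∑ j, modelMass τ β j (ϑ j)) ^ N

theorem sq_sum_abs_model_sub_le {I : Type*} [Fintype I] [DecidableEq I] [DecidableEq X]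
    [Fintype X] {ρ : Θ → ℝ} {r f : Θ → X → ℝ}
    (hρ : ∀ θ, 0 ≤ ρ θ) (hρ1 : ∑ θ, ρ θ = 1) (hf : ∀ θ x, |f θ x| ≤ r θ x)
    (hr : ∀ θ, ∑ x, r θ x = 1) (hf0 : ∀ θ, ∑ x, f θ x = 0) {δ : ℝ}
    (hδ : ∑ x, ∑ y, ∑ z, |∑ θ, ρ θ * (f θ x * f θ y * r θ z)| ≤ δ) {β γ : ℝ} (hβ : 0 < β)
    (hγ0 : 0 < γ) (hγ1 : γ ≤ 1) (hβ1 : 4 * β ^ 2 ≤ 1) {m : ℕ} (hm : 0 < m)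
    (hI : Fintype.card I = 2 * m) (x₀ : X) (c : I → ℝ) (hc : ∀ i, |c i| ≤ 1) :
    (∑ a : I → Option K, ∑ ξ : I → X,
      |mixLik (cellPrior γ ρ) (fun j _ => modelDensity m β r f x₀ 0 j) a ξ -
        mixLik (cellPrior γ ρ) (fun j i => modelDensity m β r f x₀ (c i) j) a ξ|) ^ 2 ≤
      8 * tiltMass K (2 * m) m β γ ρ ^ 2 *
        (Fintype.card K * (γ⁻¹ * (96 * δ * β ^ 4 + 1024 * β ^ 8))) := by
  have hm' : (0 : ℝ) < m := by exact_mod_cast hm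
  have hδ0 : 0 ≤ δ := le_trans (by positivity) hδ
  have key := sq_sum_abs_mixLik_sub_le (I := I) (cellPrior γ ρ)
    (fun (j : Option K) _ => modelDensity m β r f x₀ 0 j)
    (fun j i => modelDensity m β r f x₀ (c i) j) (modelMass m β)
    (cellPrior_nonneg hγ0.le hγ1 hρ) (sum_cellPrior γ hρ1)
    (fun j _ φ x => modelDensity_nonneg hm'.le hβ.le hf x₀ (by simp) j φ x)
    (fun j i φ x => modelDensity_nonneg hm'.le hβ.le hf x₀ (hc i) j φ x)
    (fun j _ φ => sum_modelDensity _ _ hr hf0 _ _ j φ)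
    (fun j _ φ => sum_modelDensity _ _ hr hf0 _ _ j φ)
    (modelMass_nonneg hm'.le hβ) m hm' none (fun _ => rfl) (by funext i φ x; rfl)
    (fun s => γ⁻¹ * (2 * β ^ 2) ^ s * marginalGap δ s / 2)
    (fun s => by have := marginalGap_nonneg hδ0 s; positivity) ?_
  · rw [hI] at key
    refine key.trans (mul_le_mul_of_nonneg_left ?_ (by positivity))
    refine mul_le_mul ?_ (sum_choose_mul_marginalGap_le hm hγ0 hβ1 hδ0)
      (Finset.sum_nonneg fun s _ => by have := marginalGap_nonneg hδ0 s; positivity) (by positivity)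
    simp [Finset.card_erase_of_mem]
  · intro a j hj
    obtain ⟨b, rfl⟩ := Option.ne_none_iff_exists'.1 hj
    refine (sum_sqrt_cellLik_sub_sq_le hρ hρ1 hf hr hf0 hδ hβ.le hγ0 hγ1
      (fun i : {i // a i = some b} => c i) fun i => hc _).trans_eq ?_
    ring

theorem sum_tilted_heavy_le (N : ℕ) {ρ : Θ → ℝ} (hρ : ∀ θ, 0 ≤ ρ θ) (hρ1 : ∑ θ, ρ θ = 1)
    {τ β γ : ℝ} (hτ : 0 < τ) (hβ : 0 < β) (hγ0 : 0 ≤ γ) (hγ1 : γ ≤ 1) (b : K) :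
    ∑ ϑ : Option K → Bool × Bool × Θ, (∏ j, cellPrior γ ρ (ϑ j)) *
      (∑ j, modelMass τ β j (ϑ j)) ^ N * (if (ϑ (some b)).1 then 1 else 0) ≤
        tiltMass K N τ β γ ρ * (γ * (1 + 1 / τ) ^ N) := by
  let π' : Option K → Bool × Bool × Θ → ℝ := fun j φ =>
    cellPrior γ ρ φ * if j = some b then (if φ.1 then 1 else 0) else 1
  have e1 : ∑ ϑ : Option K → Bool × Bool × Θ, (∏ j, cellPrior γ ρ (ϑ j)) *
      (∑ j, modelMass τ β j (ϑ j)) ^ N * (if (ϑ (some b)).1 then 1 else 0) =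
      ∑ ϑ : Option K → Bool × Bool × Θ, (∏ j, π' j (ϑ j)) *
        (∑ j, modelMass τ β j (ϑ j)) ^ N := by
    refine Finset.sum_congr rfl fun ϑ _ => ?_
    simp only [π']
    rw [Finset.prod_mul_distrib, Finset.prod_ite_eq' Finset.univ (some b)]
    simp only [Finset.mem_univ, if_true]
    ring
  have e2 := sum_prod_cellMass (I := Fin N) π' (modelMass τ β)
  rw [Fintype.card_fin] at e2
  rw [e1, ← e2]
  have e3 : ∀ a : Fin N → Option K,
      ∏ j, ∑ φ, π' j φ * modelMass τ β j φ ^ Fintype.card {i // a i = j} =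
        γ * ∏ j ∈ Finset.univ.erase (some b), ∑ φ, cellPrior γ ρ φ *
          modelMass τ β j φ ^ Fintype.card {i // a i = j} := by
    intro a
    rw [← Finset.mul_prod_erase Finset.univ _ (Finset.mem_univ (some b))]
    congr 1
    · simp only [π', if_true, modelMass, cellPrior, cellMass]
      simp_rw [Fintype.sum_prod_type, Fintype.sum_bool]
      simp only [if_true, Bool.false_eq_true, if_false, one_pow, mul_one, mul_zero, zero_mul,
        Finset.sum_const_zero, ← Finset.mul_sum, hρ1]
      ring
    · refine Finset.prod_congr rfl fun j hj => ?_
      simp [π', Finset.ne_of_mem_erase hj]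
  simp_rw [e3]
  refine (sum_cell_mul_prod_erase_le (cellPrior γ ρ) (modelMass τ β)
    (cellPrior_nonneg hγ0 hγ1 hρ) (sum_cellPrior γ hρ1) (modelMass_nonneg hτ.le hβ) τ hτ none
    (fun _ => rfl) (fun _ => γ) (fun _ => hγ0) (some b)).trans_eq ?_
  rw [Fintype.card_fin, tiltMass, add_comm (1 : ℝ), add_pow, Finset.mul_sum _ _ γ]
  congr 1
  refine Finset.sum_congr rfl fun s _ => ?_
  rw [one_pow]
  ring

end Model

theorem sum_sum_prod_eq_prod {I J X R : Type*} [Fintype I] [DecidableEq I] [Fintype J] [Fintype X]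
    [CommSemiring R] (u : J → I → X → R) :
    ∑ a : I → J, ∑ ξ : I → X, ∏ i, u (a i) i (ξ i) = ∏ i, ∑ j, ∑ x, u j i x := by
  rw [Finset.prod_univ_sum, Fintype.piFinset_univ]
  refine Finset.sum_congr rfl fun a _ => ?_
  rw [Finset.prod_univ_sum, Fintype.piFinset_univ]

theorem one_add_inv_pow_two_mul_le (m : ℕ) (hm : 0 < m) : (1 + 1 / (m : ℝ)) ^ (2 * m) ≤ 9 := by
  have hm' : (0 : ℝ) < m := by exact_mod_cast hm
  have h1 : 1 + 1 / (m : ℝ) ≤ Real.exp (1 / m) := by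
    rw [add_comm]; exact Real.add_one_le_exp _
  calc (1 + 1 / (m : ℝ)) ^ (2 * m) ≤ Real.exp (1 / m) ^ (2 * m) := by gcongr
    _ = Real.exp 1 ^ 2 := by
      rw [← Real.exp_nat_mul, ← Real.exp_nat_mul]
      congr 1
      push_cast
      field_simp
    _ ≤ 3 ^ 2 := by
      have := Real.exp_one_lt_d9
      have := Real.exp_pos 1
      gcongr
      linarith
    _ = 9 := by norm_num

section Testing

variable {K Θ X : Type*} [Fintype K] [DecidableEq K] [Fintype Θ]

omit [DecidableEq K] [Fintype Θ] in
theorem le_sum_modelMass {τ β : ℝ} (hβ : 0 < β) (ϑ : Option K → Bool × Bool × Θ) :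
    τ ≤ ∑ j, modelMass τ β j (ϑ j) := by
  rw [Fintype.sum_option]
  have : 0 ≤ ∑ b : K, modelMass τ β (some b) (ϑ (some b)) :=
    Finset.sum_nonneg fun b _ => (cellMass_pos hβ _).le
  simp only [modelMass] at this ⊢
  linarith

theorem tiltMass_pos (N : ℕ) {τ β γ : ℝ} (hτ : 0 < τ) (hβ : 0 < β) (hγ0 : 0 ≤ γ) (hγ1 : γ ≤ 1)
    {ρ : Θ → ℝ} (hρ : ∀ θ, 0 ≤ ρ θ) (hρ1 : ∑ θ, ρ θ = 1) : 0 < tiltMass K N τ β γ ρ := by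
  have h1 : ∑ ϑ : Option K → Bool × Bool × Θ, ∏ j, cellPrior γ ρ (ϑ j) = 1 := by
    have := Finset.prod_univ_sum (fun _ : Option K => (Finset.univ : Finset (Bool × Bool × Θ)))
      (fun _ φ => cellPrior γ ρ φ)
    rw [Fintype.piFinset_univ] at this
    rw [← this]
    simp [sum_cellPrior γ hρ1]
  have h2 : τ ^ N ≤ tiltMass K N τ β γ ρ := by
    rw [← one_mul (τ ^ N), ← h1, Finset.sum_mul]
    refine Finset.sum_le_sum fun ϑ _ => ?_
    have := le_sum_modelMass (τ := τ) hβ ϑ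
    have := Finset.prod_nonneg fun j (_ : j ∈ Finset.univ) =>
      cellPrior_nonneg hγ0 hγ1 hρ (ϑ j)
    gcongr
  exact (pow_pos hτ N).trans_le h2

/-- No test based on `2 * m` samples can tell the unperturbed model from the perturbed one on all
parameters with few heavy cells. -/
theorem not_distinguish_models [DecidableEq X] [Fintype X] {I : Type*} [Fintype I] [DecidableEq I]
    {ρ : Θ → ℝ} {r f : Θ → X → ℝ}
    (hρ : ∀ θ, 0 ≤ ρ θ) (hρ1 : ∑ θ, ρ θ = 1) (hf : ∀ θ x, |f θ x| ≤ r θ x)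
    (hr : ∀ θ, ∑ x, r θ x = 1) (hf0 : ∀ θ, ∑ x, f θ x = 0) {δ : ℝ}
    (hδ : ∑ x, ∑ y, ∑ z, |∑ θ, ρ θ * (f θ x * f θ y * r θ z)| ≤ δ) {β γ : ℝ} (hβ : 0 < β)
    (hγ0 : 0 < γ) (hγ1 : γ ≤ 1) (hβ1 : 4 * β ^ 2 ≤ 1) {m : ℕ} (hm : 0 < m)
    (hKγ : Fintype.card K * γ = m)
    (hI : Fintype.card I = 2 * m) (x₀ : X) (c : I → ℝ) (hc : ∀ i, |c i| ≤ 1)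
    (hsmall : Fintype.card K * (γ⁻¹ * (96 * δ * β ^ 4 + 1024 * β ^ 8)) ≤ 1 / 200)
    (T : (I → Option K) → (I → X) → ℝ) (hT0 : ∀ a ξ, 0 ≤ T a ξ) (hT1 : ∀ a ξ, T a ξ ≤ 1)
    (H0 : ∀ ϑ : Option K → Bool × Bool × Θ,
      2 / 3 * (∑ j, modelMass m β j (ϑ j)) ^ (2 * m) ≤ ∑ a : I → Option K, ∑ ξ : I → X,
        (∏ i, modelDensity m β r f x₀ 0 (a i) (ϑ (a i)) (ξ i)) * T a ξ)
    (H1 : ∀ ϑ : Option K → Bool × Bool × Θ, (∑ b, if (ϑ (some b)).1 then (1 : ℝ) else 0) ≤ 90 * m →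
      2 / 3 * (∑ j, modelMass m β j (ϑ j)) ^ (2 * m) ≤ ∑ a : I → Option K, ∑ ξ : I → X,
        (∏ i, modelDensity m β r f x₀ (c i) (a i) (ϑ (a i)) (ξ i)) * (1 - T a ξ)) : False := by
  have hm' : (0 : ℝ) < m := by exact_mod_cast hm
  have hZ := tiltMass_pos (K := K) (2 * m) hm' hβ hγ0.le hγ1 hρ hρ1
  set Z := tiltMass K (2 * m) m β γ ρ with hZd
  have key := sq_sum_abs_model_sub_le (K := K) hρ hρ1 hf hr hf0 hδ hβ hγ0 hγ1 hβ1 hm hI x₀ c hc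
  set S := ∑ a : I → Option K, ∑ ξ : I → X,
      |mixLik (cellPrior γ ρ) (fun j _ => modelDensity m β r f x₀ 0 j) a ξ -
        mixLik (cellPrior γ ρ) (fun j i => modelDensity m β r f x₀ (c i) j) a ξ| with hS
  have hS5 : S ≤ Z / 5 := by
    refine abs_le_of_sq_le_sq' ?_ (by positivity) |>.2
    rw [← hZd] at key
    nlinarith [sq_nonneg Z]
  let Q : (I → ℝ) → (Option K → Bool × Bool × Θ) → ℝ := fun c ϑ =>
    ∑ a : I → Option K, ∑ ξ : I → X,
      (∏ i, modelDensity m β r f x₀ (c i) (a i) (ϑ (a i)) (ξ i)) * T a ξ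
  let w : (Option K → Bool × Bool × Θ) → ℝ := fun ϑ => ∑ j, modelMass m β j (ϑ j)
  let h : (Option K → Bool × Bool × Θ) → ℝ := fun ϑ => ∑ b, if (ϑ (some b)).1 then (1 : ℝ) else 0
  have hpi : ∀ ϑ : Option K → Bool × Bool × Θ, 0 ≤ ∏ j, cellPrior γ ρ (ϑ j) := fun ϑ =>
    Finset.prod_nonneg fun j _ => cellPrior_nonneg hγ0.le hγ1 hρ (ϑ j)
  have hQmix : ∀ c : I → ℝ, ∑ ϑ : Option K → Bool × Bool × Θ, (∏ j, cellPrior γ ρ (ϑ j)) * Q c ϑ =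
      ∑ a : I → Option K, ∑ ξ : I → X,
        mixLik (cellPrior γ ρ) (fun j i => modelDensity m β r f x₀ (c i) j) a ξ * T a ξ := by
    intro c
    simp only [Q, mixLik, Finset.mul_sum, Finset.sum_mul]
    rw [Finset.sum_comm]
    refine Finset.sum_congr rfl fun a _ => ?_
    rw [Finset.sum_comm]
    refine Finset.sum_congr rfl fun ξ _ => Finset.sum_congr rfl fun ϑ _ => by ring
  have hupper : ∑ ϑ : Option K → Bool × Bool × Θ,
      (∏ j, cellPrior γ ρ (ϑ j)) * (Q (fun _ => 0) ϑ - Q c ϑ) ≤ S := by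
    simp_rw [mul_sub]
    rw [Finset.sum_sub_distrib, hQmix, hQmix, ← Finset.sum_sub_distrib]
    refine Finset.sum_le_sum fun a _ => ?_
    rw [← Finset.sum_sub_distrib]
    refine Finset.sum_le_sum fun ξ _ => ?_
    rw [← sub_mul]
    calc _ ≤ |mixLik (cellPrior γ ρ) (fun j _ => modelDensity m β r f x₀ 0 j) a ξ -
        mixLik (cellPrior γ ρ) (fun j i => modelDensity m β r f x₀ (c i) j) a ξ| * T a ξ :=
          mul_le_mul_of_nonneg_right (le_abs_self _) (hT0 a ξ)
      _ ≤ _ := mul_le_of_le_one_right (abs_nonneg _) (hT1 a ξ)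
  have hQtot : ∀ ϑ, ∑ a : I → Option K, ∑ ξ : I → X,
      (∏ i, modelDensity m β r f x₀ (c i) (a i) (ϑ (a i)) (ξ i)) = w ϑ ^ (2 * m) := by
    intro ϑ
    rw [sum_sum_prod_eq_prod fun j i x => modelDensity m β r f x₀ (c i) j (ϑ j) x]
    simp_rw [sum_modelDensity _ _ hr hf0]
    rw [Finset.prod_const, Finset.card_univ, hI]
  have hnn : ∀ (ϑ : Option K → Bool × Bool × Θ) (a : I → Option K) (ξ : I → X),
      0 ≤ ∏ i, modelDensity m β r f x₀ (c i) (a i) (ϑ (a i)) (ξ i) := fun ϑ a ξ =>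
    Finset.prod_nonneg fun i _ => modelDensity_nonneg hm'.le hβ.le hf x₀ (hc i) _ _ _
  have hw0 : ∀ ϑ, 0 ≤ w ϑ := fun ϑ => hm'.le.trans (le_sum_modelMass hβ ϑ)
  have hh0 : ∀ ϑ, 0 ≤ h ϑ := fun ϑ => Finset.sum_nonneg fun b _ => by split_ifs <;> norm_num
  have hQ1 : ∀ ϑ, Q c ϑ ≤ w ϑ ^ (2 * m) * (1 / 3 + h ϑ / (90 * m)) := by
    intro ϑ
    have hwp : 0 ≤ w ϑ ^ (2 * m) := pow_nonneg (hw0 ϑ) _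
    rcases le_or_gt (h ϑ) (90 * m) with hle | hgt
    · have := H1 ϑ hle
      simp_rw [mul_sub, mul_one, Finset.sum_sub_distrib] at this
      rw [hQtot] at this
      have h3 : 0 ≤ w ϑ ^ (2 * m) * (h ϑ / (90 * m)) :=
        mul_nonneg hwp (div_nonneg (hh0 ϑ) (by positivity))
      simp only [Q, w] at this h3 ⊢
      linarith
    · have h1 : Q c ϑ ≤ w ϑ ^ (2 * m) := by
        rw [← hQtot]
        exact Finset.sum_le_sum fun a _ => Finset.sum_le_sum fun ξ _ =>
          mul_le_of_le_one_right (hnn ϑ a ξ) (hT1 a ξ)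
      have h2 : 1 ≤ h ϑ / (90 * m) := by
        rw [le_div_iff₀ (by positivity)]; linarith
      refine h1.trans (le_mul_of_one_le_right hwp (by linarith))
  have hheavy : ∑ ϑ : Option K → Bool × Bool × Θ,
      (∏ j, cellPrior γ ρ (ϑ j)) * w ϑ ^ (2 * m) * h ϑ ≤ 9 * m * Z := by
    simp only [h, Finset.mul_sum]
    rw [Finset.sum_comm]
    calc _ ≤ ∑ b : K, Z * (γ * (1 + 1 / (m : ℝ)) ^ (2 * m)) :=
          Finset.sum_le_sum fun b _ => sum_tilted_heavy_le (2 * m) hρ hρ1 hm' hβ hγ0.le hγ1 b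
      _ = Z * m * (1 + 1 / (m : ℝ)) ^ (2 * m) := by
        rw [Finset.sum_const, Finset.card_univ, nsmul_eq_mul, ← hKγ]; ring
      _ ≤ Z * m * 9 := by
        have := one_add_inv_pow_two_mul_le m hm
        gcongr
      _ = 9 * m * Z := by ring
  have hlower : ∑ ϑ : Option K → Bool × Bool × Θ, (∏ j, cellPrior γ ρ (ϑ j)) *
      (w ϑ ^ (2 * m) * (1 / 3 - h ϑ / (90 * m))) ≤ S := by
    refine le_trans (Finset.sum_le_sum fun ϑ _ => ?_) hupper
    refine mul_le_mul_of_nonneg_left ?_ (hpi ϑ)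
    have h0 : 2 / 3 * w ϑ ^ (2 * m) ≤ Q (fun _ => 0) ϑ := H0 ϑ
    have h1 := hQ1 ϑ
    linarith
  have hsplit : ∑ ϑ : Option K → Bool × Bool × Θ, (∏ j, cellPrior γ ρ (ϑ j)) *
      (w ϑ ^ (2 * m) * (1 / 3 - h ϑ / (90 * m))) = Z / 3 - (∑ ϑ : Option K → Bool × Bool × Θ,
      (∏ j, cellPrior γ ρ (ϑ j)) * w ϑ ^ (2 * m) * h ϑ) / (90 * m) := by
    rw [hZd, tiltMass, Finset.sum_div, Finset.sum_div, ← Finset.sum_sub_distrib]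
    refine Finset.sum_congr rfl fun ϑ _ => ?_
    simp only [w]
    ring
  rw [hsplit] at hlower
  have : (∑ ϑ : Option K → Bool × Bool × Θ,
      (∏ j, cellPrior γ ρ (ϑ j)) * w ϑ ^ (2 * m) * h ϑ) / (90 * m) ≤ Z / 10 := by
    rw [div_le_iff₀ (by positivity)]
    linarith
  linarith

end Testing

theorem sum_prod_pairs_eq {m : ℕ} {J X : Type*} [Fintype J] [Fintype X] (g g' : J × X → ℝ)
    (F : (Fin m → J × X) → (Fin m → J × X) → ℝ) :
    ∑ d : Fin m → J × X, ∑ d' : Fin m → J × X, (∏ i, g (d i)) * (∏ i, g' (d' i)) * F d d' =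
      ∑ a : Fin m ⊕ Fin m → J, ∑ ξ : Fin m ⊕ Fin m → X,
        (∏ i, (Sum.elim (fun _ => g) (fun _ => g') i : J × X → ℝ) (a i, ξ i)) *
          F (fun i => (a (Sum.inl i), ξ (Sum.inl i))) fun i => (a (Sum.inr i), ξ (Sum.inr i)) := by
  rw [← Fintype.sum_prod_type', ← Fintype.sum_prod_type']
  let e : (Fin m → J × X) × (Fin m → J × X) ≃ (Fin m ⊕ Fin m → J) × (Fin m ⊕ Fin m → X) :=
    { toFun := fun p => (Sum.elim (fun i => (p.1 i).1) fun i => (p.2 i).1,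
        Sum.elim (fun i => (p.1 i).2) fun i => (p.2 i).2)
      invFun := fun p => (fun i => (p.1 (Sum.inl i), p.2 (Sum.inl i)),
        fun i => (p.1 (Sum.inr i), p.2 (Sum.inr i)))
      left_inv := fun p => rfl
      right_inv := fun p => by
        refine Prod.ext ?_ ?_ <;> funext i <;> cases i <;> rfl }
  refine Fintype.sum_equiv e _ _ fun p => ?_
  rw [Fintype.prod_sum_type]
  rfl

theorem le_AkDist {d k : ℕ} (p q : Measure (Fin d → ℝ)) [IsProbabilityMeasure p]
    [IsProbabilityMeasure q] (R : Fin k → Set (Fin d → ℝ))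
    (hR : ∀ i, IsAxisAlignedRectangle (R i)) (hd : Pairwise fun i j => Disjoint (R i) (R j)) :
    ∑ i, |(p (R i)).toReal - (q (R i)).toReal| ≤ AkDist k p q := by
  have hbdd : BddAbove (Set.range fun R : {R : Fin k → Set (Fin d → ℝ) //
      (∀ i, IsAxisAlignedRectangle (R i)) ∧ Pairwise fun i j => Disjoint (R i) (R j)} =>
      ∑ i, |(p (R.1 i)).toReal - (q (R.1 i)).toReal|) := by
    refine ⟨∑ _ : Fin k, 1, ?_⟩
    rintro _ ⟨R, rfl⟩
    refine Finset.sum_le_sum fun i _ => ?_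
    have h : ∀ (μ : Measure (Fin d → ℝ)) [IsProbabilityMeasure μ] (s : Set (Fin d → ℝ)),
        0 ≤ (μ s).toReal ∧ (μ s).toReal ≤ 1 := fun μ _ s =>
      ⟨ENNReal.toReal_nonneg, by
        rw [← ENNReal.toReal_one]; exact ENNReal.toReal_mono ENNReal.one_ne_top prob_le_one⟩
    have h1 := h p (R.1 i)
    have h2 := h q (R.1 i)
    rw [abs_le]
    constructor <;> linarith [h1.1, h1.2, h2.1, h2.2]
  exact le_ciSup hbdd ⟨R, hR, hd⟩

theorem gridSupported_atomicMeasure {D : Type*} [Fintype D] {V : ℕ} (pos : D → Fin 2 → ℝ)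
    (g : D → ℝ) (h : ∀ d i, ∃ j : Fin V, pos d i = (j : ℝ) + 1) :
    GridSupported V (atomicMeasure pos g) := by
  have hm : MeasurableSet {x : Fin 2 → ℝ | ∀ i, ∃ j : Fin V, x i = (j : ℝ) + 1} := by
    simp only [Set.ofPred_forall, Set.ofPred_exists]
    exact MeasurableSet.iInter fun i => MeasurableSet.iUnion fun j =>
      measurableSet_eq_fun (measurable_pi_apply i) measurable_const
  unfold GridSupported
  rw [atomicMeasure_apply _ _ hm.compl]
  refine Finset.sum_eq_zero fun d _ => ?_
  rw [Set.indicator_of_notMem, mul_zero]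
  simpa using h d

section Placement

variable {K Θ X : Type*} [Fintype K] [DecidableEq X] [Fintype X]

/-- The model as a probability measure, with cell `j` and point `x` placed at `pos (j, x)`. -/
noncomputable def modelMeasure {E : Type*} [MeasurableSpace E] (pos : Option K × X → E) (τ β : ℝ)
    (r f : Θ → X → ℝ) (x₀ : X) (ϑ : Option K → Bool × Bool × Θ) (c : ℝ) : Measure E :=
  atomicMeasure pos fun d =>
    modelDensity τ β r f x₀ c d.1 (ϑ d.1) d.2 / ∑ j, modelMass τ β j (ϑ j)

variable {τ β : ℝ} {r f : Θ → X → ℝ}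

theorem isProbabilityMeasure_modelMeasure {E : Type*} [MeasurableSpace E]
    (pos : Option K × X → E) (hτ : 0 < τ) (hβ : 0 < β) (hf : ∀ θ x, |f θ x| ≤ r θ x)
    (hr : ∀ θ, ∑ x, r θ x = 1) (hf0 : ∀ θ, ∑ x, f θ x = 0) (x₀ : X)
    (ϑ : Option K → Bool × Bool × Θ) {c : ℝ} (hc : |c| ≤ 1) :
    IsProbabilityMeasure (modelMeasure pos τ β r f x₀ ϑ c) := by
  have hw : 0 < ∑ j, modelMass τ β j (ϑ j) := hτ.trans_le (le_sum_modelMass hβ ϑ)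
  refine isProbabilityMeasure_atomicMeasure pos
    (fun d => div_nonneg (modelDensity_nonneg hτ.le hβ.le hf x₀ hc _ _ _) hw.le) ?_
  rw [← Finset.sum_div, Fintype.sum_prod_type]
  simp_rw [sum_modelDensity _ _ hr hf0]
  exact div_self hw.ne'

theorem integral_modelMeasure {E : Type*} [MeasurableSpace E]
    (pos : Option K × X → E) (hτ : 0 < τ) (hβ : 0 < β) (hf : ∀ θ x, |f θ x| ≤ r θ x) (x₀ : X)
    (ϑ : Option K → Bool × Bool × Θ) {c c' : ℝ} (hc : |c| ≤ 1) (hc' : |c'| ≤ 1) {m : ℕ}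
    {F : (Fin m → E) × (Fin m → E) → ℝ} (hF : Measurable F) :
    ∫ s, F s ∂((Measure.pi fun _ : Fin m => modelMeasure pos τ β r f x₀ ϑ c).prod
        (Measure.pi fun _ : Fin m => modelMeasure pos τ β r f x₀ ϑ c')) =
      (∑ a : Fin m ⊕ Fin m → Option K, ∑ ξ : Fin m ⊕ Fin m → X,
        (∏ i, modelDensity τ β r f x₀ (Sum.elim (fun _ => c) (fun _ => c') i) (a i)
          (ϑ (a i)) (ξ i)) *
          F (fun i => pos (a (Sum.inl i), ξ (Sum.inl i)),
            fun i => pos (a (Sum.inr i), ξ (Sum.inr i)))) /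
        (∑ j, modelMass τ β j (ϑ j)) ^ (2 * m) := by
  have hw : 0 < ∑ j, modelMass τ β j (ϑ j) := hτ.trans_le (le_sum_modelMass hβ ϑ)
  have hg : ∀ {c : ℝ}, |c| ≤ 1 → ∀ d : Option K × X,
      0 ≤ modelDensity τ β r f x₀ c d.1 (ϑ d.1) d.2 / ∑ j, modelMass τ β j (ϑ j) := fun hc d =>
    div_nonneg (modelDensity_nonneg hτ.le hβ.le hf x₀ hc _ _ _) hw.le
  unfold modelMeasure
  rw [integral_pi_prod_pi_atomicMeasure pos (hg hc) (hg hc') hF,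
    sum_prod_pairs_eq
      (fun d => modelDensity τ β r f x₀ c d.1 (ϑ d.1) d.2 / ∑ j, modelMass τ β j (ϑ j))
      (fun d => modelDensity τ β r f x₀ c' d.1 (ϑ d.1) d.2 / ∑ j, modelMass τ β j (ϑ j))
      fun d d' => F (fun i => pos (d i), fun i => pos (d' i)), Finset.sum_div]
  refine Finset.sum_congr rfl fun a _ => ?_
  rw [Finset.sum_div]
  refine Finset.sum_congr rfl fun ξ _ => ?_
  rw [mul_div_right_comm]
  congr 1
  simp only [Fintype.prod_sum_type, Sum.elim_inl, Sum.elim_inr, Finset.prod_div_distrib,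
    Finset.prod_const, Finset.card_univ, Fintype.card_fin]
  rw [two_mul, pow_add, div_mul_div_comm]

/-- A closeness test has to fail on some pair of model measures. -/
theorem not_test_model [DecidableEq K] [Fintype Θ] {k V : ℕ}
    (pos : Option K × X → Fin 2 → ℝ) (hpos : ∀ d i, ∃ j : Fin V, pos d i = (j : ℝ) + 1)
    {ρ : Θ → ℝ}
    (hρ : ∀ θ, 0 ≤ ρ θ) (hρ1 : ∑ θ, ρ θ = 1) (hf : ∀ θ x, |f θ x| ≤ r θ x)
    (hr : ∀ θ, ∑ x, r θ x = 1) (hf0 : ∀ θ, ∑ x, f θ x = 0) {δ : ℝ}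
    (hδ : ∑ x, ∑ y, ∑ z, |∑ θ, ρ θ * (f θ x * f θ y * r θ z)| ≤ δ) {γ : ℝ} (hβ : 0 < β)
    (hγ0 : 0 < γ) (hγ1 : γ ≤ 1) (hβ1 : 4 * β ^ 2 ≤ 1) {m : ℕ} (hm : 0 < m)
    (hKγ : Fintype.card K * γ = m) (x₀ : X)
    (hsmall : Fintype.card K * (γ⁻¹ * (96 * δ * β ^ 4 + 1024 * β ^ 8)) ≤ 1 / 200) {ε : ℝ}
    (hε : ∀ ϑ : Option K → Bool × Bool × Θ,
      (∑ b, if (ϑ (some b)).1 then (1 : ℝ) else 0) ≤ 90 * m →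
      ε ≤ AkDist k (modelMeasure pos m β r f x₀ ϑ 1) (modelMeasure pos m β r f x₀ ϑ (-1)))
    (T : (Fin m → (Fin 2 → ℝ)) × (Fin m → (Fin 2 → ℝ)) → ℝ) (hT : Measurable T)
    (hT01 : ∀ s, T s ∈ Set.Icc (0 : ℝ) 1)
    (htest : ∀ p q : Measure (Fin 2 → ℝ),
      IsProbabilityMeasure p → IsProbabilityMeasure q →
      GridSupported V p → GridSupported V q →
      (p = q →
        (2 : ℝ) / 3 ≤ ∫ s, T s ∂((Measure.pi fun _ : Fin m => p).prod
            (Measure.pi fun _ : Fin m => q))) ∧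
      (ε ≤ AkDist k p q →
        (2 : ℝ) / 3 ≤ ∫ s, (1 - T s) ∂((Measure.pi fun _ : Fin m => p).prod
            (Measure.pi fun _ : Fin m => q)))) : False := by
  have hm' : (0 : ℝ) < m := by exact_mod_cast hm
  have h1 : |(1 : ℝ)| ≤ 1 := by norm_num
  have hn1 : |(-1 : ℝ)| ≤ 1 := by norm_num
  have h0 : |(0 : ℝ)| ≤ 1 := by norm_num
  have hw : ∀ ϑ : Option K → Bool × Bool × Θ, 0 < ∑ j, modelMass m β j (ϑ j) := fun ϑ =>
    hm'.trans_le (le_sum_modelMass hβ ϑ)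
  have hprob : ∀ ϑ {c : ℝ}, |c| ≤ 1 →
      IsProbabilityMeasure (modelMeasure pos m β r f x₀ ϑ c) := fun ϑ c hc =>
    isProbabilityMeasure_modelMeasure pos hm' hβ hf hr hf0 x₀ ϑ hc
  have hgrid : ∀ ϑ c, GridSupported V (modelMeasure pos m β r f x₀ ϑ c) := fun ϑ c =>
    gridSupported_atomicMeasure pos _ hpos
  refine not_distinguish_models (I := Fin m ⊕ Fin m) hρ hρ1 hf hr hf0 hδ hβ hγ0 hγ1 hβ1 hm hKγ
    (by rw [Fintype.card_sum, Fintype.card_fin, two_mul]) x₀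
    (Sum.elim (fun _ => 1) fun _ => -1) (by rintro (i | i) <;> simp) hsmall
    (fun a ξ => T (fun i => pos (a (Sum.inl i), ξ (Sum.inl i)),
      fun i => pos (a (Sum.inr i), ξ (Sum.inr i))))
    (fun a ξ => (hT01 _).1) (fun a ξ => (hT01 _).2) (fun ϑ => ?_) fun ϑ hϑ => ?_
  · have := (htest _ _ (hprob ϑ h0) (hprob ϑ h0) (hgrid ϑ 0) (hgrid ϑ 0)).1 rfl
    rw [integral_modelMeasure pos hm' hβ hf x₀ ϑ h0 h0 hT,
      le_div_iff₀ (pow_pos (hw ϑ) _)] at this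
    refine this.trans_eq (Finset.sum_congr rfl fun a _ => Finset.sum_congr rfl fun ξ _ => ?_)
    congr 1
    refine Finset.prod_congr rfl fun i _ => ?_
    cases i <;> rfl
  · have := (htest _ _ (hprob ϑ h1) (hprob ϑ hn1) (hgrid ϑ 1) (hgrid ϑ (-1))).2 (hε ϑ hϑ)
    rwa [integral_modelMeasure pos hm' hβ hf x₀ ϑ h1 hn1 (F := fun s => 1 - T s)
      (measurable_const.sub hT),
      le_div_iff₀ (pow_pos (hw ϑ) _)] at this

end Placement

section Grid

/-- Position of a cell in a square array; the reservoir comes after all other cells. -/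
def cellIndex {k : ℕ} : Option (Fin k) → ℕ
  | none => k
  | some b => b

theorem cellIndex_le {k : ℕ} (j : Option (Fin k)) : cellIndex j ≤ k := by
  cases j with
  | none => exact le_rfl
  | some b => exact b.2.le

theorem cellIndex_eq_coe {k : ℕ} {j : Option (Fin k)} {b : Fin k} :
    cellIndex j = b ↔ j = some b := by
  cases j with
  | none => simp [cellIndex, b.2.ne']
  | some c => simp [cellIndex, Fin.ext_iff]

/-- Grid point of cell `j` with local coordinates `x`, in an array of width `R` with cells of side
`W`. -/
def gridCoord {k W : ℕ} (R : ℕ) (d : Option (Fin k) × Fin W × Fin W) : Fin 2 → ℕ :=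
  ![cellIndex d.1 / R * W + d.2.1, cellIndex d.1 % R * W + d.2.2]

theorem gridCoord_lt {k W R : ℕ} (hR : k < R * R) (d : Option (Fin k) × Fin W × Fin W)
    (i : Fin 2) : gridCoord R d i < R * W := by
  have h0 : 0 < R := Nat.pos_of_ne_zero (by rintro rfl; simp at hR)
  have key : ∀ q x, q < R → x < W → q * W + x < R * W := fun q x hq hx => by
    have : (q + 1) * W ≤ R * W := Nat.mul_le_mul_right W hq
    linarith
  fin_cases i
  · exact key _ _ (Nat.div_lt_of_lt_mul ((cellIndex_le _).trans_lt hR)) d.2.1.2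
  · exact key _ _ (Nat.mod_lt _ h0) d.2.2.2

/-- Lower left part of cell `b`, of side lengths `t 0` and `t 1`. -/
def cellRect (R W b : ℕ) (t : Fin 2 → ℕ) : Set (Fin 2 → ℝ) :=
  Set.univ.pi fun i => Set.Ico ((![b / R * W, b % R * W] i : ℕ) + 1 : ℝ)
    ((![b / R * W, b % R * W] i + t i : ℕ) + 1 : ℝ)

theorem isAxisAlignedRectangle_cellRect (R W b : ℕ) (t : Fin 2 → ℕ) :
    IsAxisAlignedRectangle (cellRect R W b t) :=
  ⟨_, fun _ => Set.ordConnected_Ico, rfl⟩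

theorem measurableSet_cellRect (R W b : ℕ) (t : Fin 2 → ℕ) :
    MeasurableSet (cellRect R W b t) :=
  MeasurableSet.univ_pi fun _ => measurableSet_Ico

theorem eq_of_mul_add_lt {q q' W x : ℕ} (hx : x < W) {t : ℕ} (ht : t ≤ W)
    (h1 : q * W ≤ q' * W + x) (h2 : q' * W + x < q * W + t) : q' = q := by
  rcases lt_trichotomy q' q with h | h | h
  · have : (q' + 1) * W ≤ q * W := Nat.mul_le_mul_right W h
    linarith
  · exact h
  · have : (q + 1) * W ≤ q' * W := Nat.mul_le_mul_right W h
    linarith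

theorem gridCoord_mem_cellRect {k W R : ℕ} {b : Fin k} {t : Fin 2 → ℕ} (ht : ∀ i, t i ≤ W)
    (d : Option (Fin k) × Fin W × Fin W) :
    (fun i => (gridCoord R d i : ℝ) + 1) ∈ cellRect R W b t ↔
      d.1 = some b ∧ (d.2.1 : ℕ) < t 0 ∧ (d.2.2 : ℕ) < t 1 := by
  have : (fun i => (gridCoord R d i : ℝ) + 1) ∈ cellRect R W b t ↔
      (b / R * W ≤ cellIndex d.1 / R * W + d.2.1 ∧
        cellIndex d.1 / R * W + d.2.1 < b / R * W + t 0) ∧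
      (b % R * W ≤ cellIndex d.1 % R * W + d.2.2 ∧
        cellIndex d.1 % R * W + d.2.2 < b % R * W + t 1) := by
    simp only [cellRect, Set.mem_univ_pi, Fin.forall_fin_two, Set.mem_Ico, add_le_add_iff_right,
      add_lt_add_iff_right, Nat.cast_le, Nat.cast_lt]
    rfl
  rw [this]
  constructor
  · rintro ⟨⟨a1, a2⟩, a3, a4⟩
    have e1 := eq_of_mul_add_lt d.2.1.2 (ht 0) a1 a2
    have e2 := eq_of_mul_add_lt d.2.2.2 (ht 1) a3 a4
    rw [e1] at a2
    rw [e2] at a4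
    refine ⟨cellIndex_eq_coe.1 ?_, by omega, by omega⟩
    rw [← Nat.div_add_mod (cellIndex d.1) R, ← Nat.div_add_mod (b : ℕ) R, e1, e2]
  · rintro ⟨e, a1, a2⟩
    rw [e]
    simp only [cellIndex]
    omega

theorem disjoint_cellRect {R W b b' : ℕ} {t t' : Fin 2 → ℕ} (ht : ∀ i, t i ≤ W)
    (ht' : ∀ i, t' i ≤ W) (h : b ≠ b') : Disjoint (cellRect R W b t) (cellRect R W b' t') := by
  have key : ∀ (q q' : ℕ) (i : Fin 2) (y : ℝ), (q * W : ℕ) + 1 ≤ y → y < (q * W + t i : ℕ) + 1 →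
      (q' * W : ℕ) + 1 ≤ y → y < (q' * W + t' i : ℕ) + 1 → q = q' := by
    intro q q' i y a1 a2 a3 a4
    have b1 : q * W < q' * W + t' i := by
      have := a1.trans_lt a4
      have := lt_of_add_lt_add_right this
      exact_mod_cast this
    have b2 : q' * W < q * W + t i := by
      have := a3.trans_lt a2
      have := lt_of_add_lt_add_right this
      exact_mod_cast this
    have := ht i
    have := ht' i
    rcases lt_trichotomy q' q with h | h | h
    · have : (q' + 1) * W ≤ q * W := Nat.mul_le_mul_right W h
      linarith
    · exact h.symm
    · have : (q + 1) * W ≤ q' * W := Nat.mul_le_mul_right W h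
      linarith
  rw [Set.disjoint_left]
  intro y hy hy'
  simp only [cellRect, Set.mem_univ_pi, Fin.forall_fin_two, Set.mem_Ico] at hy hy'
  have e1 := key _ _ 0 _ hy.1.1 hy.1.2 hy'.1.1 hy'.1.2
  have e2 := key _ _ 1 _ hy.2.1 hy.2.2 hy'.2.1 hy'.2.2
  exact h (by rw [← Nat.div_add_mod b R, ← Nat.div_add_mod b' R, e1, e2])

variable {k B n : ℕ}

/-- Placement of the model on the grid. -/
def gridPos (R : ℕ) (d : Option (Fin k) × Fin (3 * B ^ n) × Fin (3 * B ^ n)) : Fin 2 → ℝ :=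
  fun i => (gridCoord R d i : ℝ) + 1

theorem abs_modelMeasure_cellRect_sub (hB : 0 < B) (hn : 0 < n) (R : ℕ) {τ β : ℝ} (hτ : 0 < τ)
    (hβ : 0 < β) (x₀ : Fin (3 * B ^ n) × Fin (3 * B ^ n))
    (ϑ : Option (Fin k) → Bool × Bool × Fin (B ^ n) × Fin (B ^ n)) (b : Fin k) :
    let s := cellRect R (3 * B ^ n) b
      ![B ^ n + (ϑ (some b)).2.2.1, B ^ n + (ϑ (some b)).2.2.2]
    |(modelMeasure (gridPos R) τ β (binDensity B n) (binBump B n) x₀ ϑ 1 s).toReal -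
      (modelMeasure (gridPos R) τ β (binDensity B n) (binBump B n) x₀ ϑ (-1) s).toReal| =
      (1 - if (ϑ (some b)).1 then 1 else 0) * (β / (2 * ∑ j, modelMass τ β j (ϑ j))) := by
  classical
  intro s
  have hw : 0 < ∑ j, modelMass τ β j (ϑ j) := hτ.trans_le (le_sum_modelMass hβ ϑ)
  set w := ∑ j, modelMass τ β j (ϑ j)
  set θ := (ϑ (some b)).2.2 with hθ
  have hmem : ∀ d : Option (Fin k) × Fin (3 * B ^ n) × Fin (3 * B ^ n), gridPos R d ∈ s ↔
      d.1 = some b ∧ (d.2.1 : ℕ) < B ^ n + θ.1 ∧ (d.2.2 : ℕ) < B ^ n + θ.2 := fun d =>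
    gridCoord_mem_cellRect (t := ![B ^ n + (θ.1 : ℕ), B ^ n + (θ.2 : ℕ)])
      (by rw [Fin.forall_fin_two]; have := θ.1.2; have := θ.2.2; simp; omega) d
  have hs : MeasurableSet s := measurableSet_cellRect _ _ _ _
  clear_value s
  have hval : ∀ c : ℝ, |c| ≤ 1 →
      (modelMeasure (gridPos R) τ β (binDensity B n) (binBump B n) x₀ ϑ c s).toReal =
        ∑ x : Fin (3 * B ^ n) × Fin (3 * B ^ n),
          if (x.1 : ℕ) < B ^ n + θ.1 ∧ (x.2 : ℕ) < B ^ n + θ.2 then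
            cellDensity β (binDensity B n) (binBump B n) c (ϑ (some b)) x / w else 0 := by
    intro c hc
    unfold modelMeasure
    rw [toReal_atomicMeasure_apply _ (fun d => div_nonneg (modelDensity_nonneg hτ.le hβ.le
      (abs_binBump_le B n) x₀ hc _ _ _) hw.le) hs,
      Fintype.sum_prod_type, Finset.sum_eq_single (some b)]
    · refine Finset.sum_congr rfl fun x _ => ?_
      simp only [hmem, true_and, modelDensity]
    · intro j _ hj
      refine Finset.sum_eq_zero fun x _ => ?_
      simp [hmem, hj]
    · simp
  rw [hval 1 (by norm_num), hval (-1) (by norm_num), ← Finset.sum_sub_distrib]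
  by_cases hh : (ϑ (some b)).1
  · simp [cellDensity, hh]
  · have e : ∀ x : Fin (3 * B ^ n) × Fin (3 * B ^ n),
        ((if (x.1 : ℕ) < B ^ n + θ.1 ∧ (x.2 : ℕ) < B ^ n + θ.2 then
            cellDensity β (binDensity B n) (binBump B n) 1 (ϑ (some b)) x / w else 0) -
          if (x.1 : ℕ) < B ^ n + θ.1 ∧ (x.2 : ℕ) < B ^ n + θ.2 then
            cellDensity β (binDensity B n) (binBump B n) (-1) (ϑ (some b)) x / w else 0) =
        (2 * β * (if (ϑ (some b)).2.1 then 1 else -1) / w) *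
          if (x.1 : ℕ) < B ^ n + θ.1 ∧ (x.2 : ℕ) < B ^ n + θ.2 then binBump B n θ x else 0 := by
      intro x
      simp only [cellDensity, hh, Bool.false_eq_true, if_false, ← hθ]
      split_ifs <;> ring
    simp_rw [e]
    rw [← Finset.mul_sum, sum_binBump_quadrant hB hn]
    simp only [hh, Bool.false_eq_true, if_false, sub_zero, one_mul]
    have : ∀ σ : ℝ, |σ| = 1 → |2 * β * σ / w * (1 / 4)| = β / (2 * w) := by
      intro σ hσ
      rw [abs_mul, abs_div, abs_mul, hσ, abs_of_pos hw, abs_of_pos (by positivity : 0 < 2 * β),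
        abs_of_pos (by norm_num : (0 : ℝ) < 1 / 4)]
      field_simp
      norm_num
    apply this
    split_ifs <;> simp

theorem le_AkDist_modelMeasure (hB : 0 < B) (hn : 0 < n) (R : ℕ) {β : ℝ} (hβ : 0 < β) {m : ℕ}
    (hm : 0 < m) (hkm : 180 * (m : ℝ) ≤ k) (hkβ : k * β ≤ m)
    (x₀ : Fin (3 * B ^ n) × Fin (3 * B ^ n))
    (ϑ : Option (Fin k) → Bool × Bool × Fin (B ^ n) × Fin (B ^ n))
    (hϑ : (∑ b, if (ϑ (some b)).1 then (1 : ℝ) else 0) ≤ 90 * m) :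
    k * β / (368 * m) ≤
      AkDist k (modelMeasure (gridPos R) m β (binDensity B n) (binBump B n) x₀ ϑ 1)
        (modelMeasure (gridPos R) m β (binDensity B n) (binBump B n) x₀ ϑ (-1)) := by
  have hm' : (0 : ℝ) < m := by exact_mod_cast hm
  have hw : 0 < ∑ j, modelMass m β j (ϑ j) := hm'.trans_le (le_sum_modelMass hβ ϑ)
  have hprob : ∀ {c : ℝ}, |c| ≤ 1 → IsProbabilityMeasure
      (modelMeasure (gridPos R) m β (binDensity B n) (binBump B n) x₀ ϑ c) := fun hc =>
    isProbabilityMeasure_modelMeasure _ hm' hβ (abs_binBump_le B n) (sum_binDensity hB hn)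
      (sum_binBump hB) x₀ ϑ hc
  have h1 := hprob (c := 1) (by norm_num)
  have h2 := hprob (c := -1) (by norm_num)
  have ht : ∀ (b : Fin k) (i : Fin 2), (![B ^ n + ((ϑ (some b)).2.2.1 : ℕ),
      B ^ n + ((ϑ (some b)).2.2.2 : ℕ)] : Fin 2 → ℕ) i ≤ 3 * B ^ n := by
    intro b
    rw [Fin.forall_fin_two]
    have := (ϑ (some b)).2.2.1.2
    have := (ϑ (some b)).2.2.2.2
    simp
    omega
  refine le_trans ?_ (le_AkDist _ _ (fun b : Fin k => cellRect R (3 * B ^ n) b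
    ![B ^ n + (ϑ (some b)).2.2.1, B ^ n + (ϑ (some b)).2.2.2])
    (fun b => isAxisAlignedRectangle_cellRect _ _ _ _)
    fun b b' hb => disjoint_cellRect (ht b) (ht b') fun h => hb (Fin.ext h))
  rw [Finset.sum_congr rfl fun b _ =>
    abs_modelMeasure_cellRect_sub hB hn R hm' hβ x₀ ϑ b, ← Finset.sum_mul, Finset.sum_sub_distrib]
  set h := ∑ b, if (ϑ (some b)).1 then (1 : ℝ) else 0 with hh
  have hwle : ∑ j, modelMass m β j (ϑ j) ≤ 92 * m := by
    rw [Fintype.sum_option]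
    have : ∑ b : Fin k, modelMass m β (some b) (ϑ (some b)) ≤ h + k * β := by
      have e : (k : ℝ) * β = ∑ _b : Fin k, β := by simp
      rw [e, hh, ← Finset.sum_add_distrib]
      refine Finset.sum_le_sum fun b _ => ?_
      simp only [modelMass, cellMass]
      split_ifs <;> linarith
    simp only [modelMass] at this ⊢
    linarith
  simp only [Finset.sum_const, Finset.card_univ, Fintype.card_fin, nsmul_eq_mul, mul_one]
  calc k * β / (368 * m) = (k - k / 2) * (β / (2 * (92 * m))) := by field_simp; ring
    _ ≤ (k - h) * (β / (2 * ∑ j, modelMass m β j (ϑ j))) := by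
      gcongr
      · linarith
      · linarith

end Grid

/-- The lower bound for grids that have room for `k` cells of side `3 * n ^ n`. -/
theorem not_test_of_le {V k m n : ℕ} (hm : 0 < m) (hn : 0 < n) (hkV : k ≤ V)
    (hV : (V.sqrt + 1) * (3 * n ^ n) ≤ V) {ε : ℝ} (hε0 : 0 < ε) (hε1 : 368 * ε ≤ 1)
    (hkm : 180 * (m : ℝ) ≤ k) (h3 : 400 * 768 * (368 * ε) ^ 4 * (m : ℝ) ^ 3 ≤ n * (k : ℝ) ^ 2)
    (h7 : 400 * 1024 * (368 * ε) ^ 8 * (m : ℝ) ^ 7 ≤ (k : ℝ) ^ 6)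
    (T : (Fin m → (Fin 2 → ℝ)) × (Fin m → (Fin 2 → ℝ)) → ℝ) (hT : Measurable T)
    (hT01 : ∀ s, T s ∈ Set.Icc (0 : ℝ) 1)
    (htest : ∀ p q : Measure (Fin 2 → ℝ),
      IsProbabilityMeasure p → IsProbabilityMeasure q →
      GridSupported V p → GridSupported V q →
      (p = q →
        (2 : ℝ) / 3 ≤ ∫ s, T s ∂((Measure.pi fun _ : Fin m => p).prod
            (Measure.pi fun _ : Fin m => q))) ∧
      (ε ≤ AkDist k p q →
        (2 : ℝ) / 3 ≤ ∫ s, (1 - T s) ∂((Measure.pi fun _ : Fin m => p).prod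
            (Measure.pi fun _ : Fin m => q)))) : False := by
  have hm' : (0 : ℝ) < m := by exact_mod_cast hm
  have hn' : (0 : ℝ) < n := by exact_mod_cast hn
  have hk' : (0 : ℝ) < k := by linarith
  set η := 368 * ε with hη
  have hη0 : 0 < η := by positivity
  have hγ : (m : ℝ) / k ≤ 1 / 180 := by
    rw [div_le_div_iff₀ hk' (by norm_num)]; linarith
  have hkβ : (k : ℝ) * (η * m / k) = η * m := by field_simp
  have hR : k < (V.sqrt + 1) * (V.sqrt + 1) := hkV.trans_lt (Nat.lt_succ_sqrt V)
  have hβ0 : 0 < η * m / k := by positivity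
  have hβ1 : η * m / k ≤ 1 / 180 := by
    rw [mul_div_assoc]
    exact (mul_le_of_le_one_left (by positivity) hε1).trans hγ
  have hpow : 0 < 3 * n ^ n := by positivity
  have hcard : (∑ _θ : Fin (n ^ n) × Fin (n ^ n), 1 / ((n : ℝ) ^ n * (n : ℝ) ^ n)) = 1 := by
    rw [Finset.sum_const, Finset.card_univ, Fintype.card_prod, Fintype.card_fin, nsmul_eq_mul]
    push_cast
    field_simp
  refine not_test_model (K := Fin k) (X := Fin (3 * n ^ n) × Fin (3 * n ^ n))
    (Θ := Fin (n ^ n) × Fin (n ^ n)) (V := V) (k := k) (gridPos (V.sqrt + 1)) ?_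
    (ρ := fun _ => 1 / ((n : ℝ) ^ n * (n : ℝ) ^ n)) (fun _ => by positivity) hcard
    (abs_binBump_le n n) (sum_binDensity hn hn) (sum_binBump hn) (δ := 8 / n) ?_ hβ0
    (by positivity : 0 < (m : ℝ) / k) (hγ.trans (by norm_num)) ?_ hm ?_
    (⟨0, hpow⟩, ⟨0, hpow⟩) ?_ (ε := ε) ?_ T hT hT01 htest
  · intro d i
    exact ⟨⟨_, (gridCoord_lt hR d i).trans_le hV⟩, rfl⟩
  · have := sum_abs_sum_binBump_le (B := n) (n := n) hn hn
    simp_rw [← Finset.mul_sum, abs_mul, ← Finset.mul_sum]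
    rw [abs_of_nonneg (by positivity), one_div, inv_mul_le_iff₀ (by positivity)]
    refine this.trans_eq ?_
    congr 1
    ring
  · nlinarith
  · rw [Fintype.card_fin]; field_simp
  · rw [Fintype.card_fin]
    have e : (k : ℝ) * (((m : ℝ) / k)⁻¹ * (96 * (8 / n) * (η * m / k) ^ 4 +
        1024 * (η * m / k) ^ 8)) = 768 * η ^ 4 * (m : ℝ) ^ 3 / (n * (k : ℝ) ^ 2) +
          1024 * η ^ 8 * (m : ℝ) ^ 7 / (k : ℝ) ^ 6 := by
      field_simp
      ring
    rw [e]
    have a1 : 768 * η ^ 4 * (m : ℝ) ^ 3 / (n * (k : ℝ) ^ 2) ≤ 1 / 400 := by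
      rw [div_le_div_iff₀ (by positivity) (by norm_num)]; linarith
    have a2 : 1024 * η ^ 8 * (m : ℝ) ^ 7 / (k : ℝ) ^ 6 ≤ 1 / 400 := by
      rw [div_le_div_iff₀ (by positivity) (by norm_num)]; linarith
    linarith
  · intro ϑ hϑ
    have := le_AkDist_modelMeasure hn hn (V.sqrt + 1) hβ0 hm hkm
      (by rw [hkβ]; exact mul_le_of_le_one_left hm'.le hε1) (⟨0, hpow⟩, ⟨0, hpow⟩) ϑ hϑ
    rw [hkβ] at this
    refine le_trans (le_of_eq ?_) this
    rw [hη]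
    field_simp

/-- Without samples no test can succeed on a grid with at least two points. -/
theorem not_test_zero {V k : ℕ} (hV : 2 ≤ V) (hk : 0 < k) {ε : ℝ} (hε1 : ε ≤ 1)
    (T : (Fin 0 → (Fin 2 → ℝ)) × (Fin 0 → (Fin 2 → ℝ)) → ℝ) (hT : Measurable T)
    (htest : ∀ p q : Measure (Fin 2 → ℝ),
      IsProbabilityMeasure p → IsProbabilityMeasure q →
      GridSupported V p → GridSupported V q →
      (p = q →
        (2 : ℝ) / 3 ≤ ∫ s, T s ∂((Measure.pi fun _ : Fin 0 => p).prod
            (Measure.pi fun _ : Fin 0 => q))) ∧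
      (ε ≤ AkDist k p q →
        (2 : ℝ) / 3 ≤ ∫ s, (1 - T s) ∂((Measure.pi fun _ : Fin 0 => p).prod
            (Measure.pi fun _ : Fin 0 => q)))) : False := by
  classical
  let μ : ℕ → Measure (Fin 2 → ℝ) := fun j =>
    atomicMeasure (fun (_ : Unit) _ => (j : ℝ) + 1) fun _ => 1
  have hμ : ∀ j, IsProbabilityMeasure (μ j) := fun j =>
    isProbabilityMeasure_atomicMeasure _ (fun _ => zero_le_one) (by simp)
  have hgrid : ∀ j < 2, GridSupported V (μ j) := fun j hj =>
    gridSupported_atomicMeasure _ _ fun _ _ => ⟨⟨j, hj.trans_le hV⟩, rfl⟩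
  have h_int : ∀ (i j : ℕ) (F : (Fin 0 → (Fin 2 → ℝ)) × (Fin 0 → (Fin 2 → ℝ)) → ℝ),
      Measurable F → ∫ s, F s ∂((Measure.pi fun _ : Fin 0 => μ i).prod
        (Measure.pi fun _ : Fin 0 => μ j)) = F default := by
    intro i j F _
    have : F = fun _ => F default := funext fun s => congrArg F (Subsingleton.elim _ _)
    rw [this]
    simp
  have hAk : ε ≤ AkDist k (μ 0) (μ 1) := by
    have h0 := hμ 0
    have h1 := hμ 1
    have hval : ∀ (j : ℕ) (i : Fin k),
        (μ j (Set.univ.pi fun _ => {((i : ℕ) : ℝ) + 1})).toReal = if j = i then 1 else 0 := by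
      intro j i
      rw [toReal_atomicMeasure_apply _ (fun _ => zero_le_one)
        (MeasurableSet.univ_pi fun _ => measurableSet_singleton _)]
      simp
    refine le_trans ?_ (le_AkDist (μ 0) (μ 1)
      (fun i : Fin k => Set.univ.pi fun _ => {((i : ℕ) : ℝ) + 1})
      (fun i => ⟨_, fun _ => Set.ordConnected_singleton, rfl⟩) fun i j hij => ?_)
    · refine le_trans ?_ (Finset.single_le_sum (f := fun i : Fin k =>
        |(μ 0 (Set.univ.pi fun _ => {((i : ℕ) : ℝ) + 1})).toReal -
          (μ 1 (Set.univ.pi fun _ => {((i : ℕ) : ℝ) + 1})).toReal|)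
        (fun i _ => abs_nonneg _) (Finset.mem_univ ⟨0, hk⟩))
      rw [hval, hval]
      simpa using hε1
    · change Disjoint _ _
      rw [Set.disjoint_left]
      intro y hy hy'
      have e1 := hy 0 (Set.mem_univ _)
      have e2 := hy' 0 (Set.mem_univ _)
      simp only [Set.mem_singleton_iff] at e1 e2
      rw [e1] at e2
      have := add_right_cancel e2
      exact hij (Fin.ext (by exact_mod_cast this))
  have a0 := (htest _ _ (hμ 0) (hμ 0) (hgrid 0 (by norm_num)) (hgrid 0 (by norm_num))).1 rfl
  have a1 := (htest _ _ (hμ 0) (hμ 1) (hgrid 0 (by norm_num)) (hgrid 1 (by norm_num))).2 hAk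
  rw [h_int 0 0 T hT] at a0
  rw [h_int 0 1 (fun s => 1 - T s) (measurable_const.sub hT)] at a1
  linarith

theorem two_mul_sq_add_le_two_pow {n : ℕ} (hn : 10 ≤ n) : 2 * (n * n) + 6 ≤ 2 ^ (n - 1) := by
  induction n, hn using Nat.le_induction with
  | base => norm_num
  | succ n hn ih =>
    obtain ⟨l, rfl⟩ : ∃ l, n = l + 1 := ⟨n - 1, by omega⟩
    simp only [Nat.add_sub_cancel] at ih ⊢
    rw [pow_succ]
    nlinarith

/-- Growth conditions on the grid size. -/
theorem exists_forall_grid_growth : ∃ V₀ : ℕ, 2 ≤ V₀ ∧ ∀ V : ℕ, V₀ ≤ V →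
    ∃ n : ℕ, 0 < n ∧ (V.sqrt + 1) * (3 * n ^ n) ≤ V ∧
      0 ≤ Real.log (Real.log V) / Real.log (Real.log (Real.log V)) ∧
      Real.log (Real.log V) / Real.log (Real.log (Real.log V)) ≤ n := by
  have ht : Filter.Tendsto (fun V : ℕ => Real.log (Real.log (Real.log V))) Filter.atTop
      Filter.atTop := Real.tendsto_log_atTop.comp (Real.tendsto_log_atTop.comp
    (Real.tendsto_log_atTop.comp tendsto_natCast_atTop_atTop))
  have ht2 : Filter.Tendsto (fun V : ℕ => Real.log (Real.log V)) Filter.atTop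
      Filter.atTop := Real.tendsto_log_atTop.comp
    (Real.tendsto_log_atTop.comp tendsto_natCast_atTop_atTop)
  obtain ⟨V₁, hV₁⟩ := Filter.eventually_atTop.1
    ((ht.eventually_ge_atTop 1).and (ht2.eventually_ge_atTop 0))
  refine ⟨max V₁ (max 2 (2 ^ (2 ^ 9))), le_max_of_le_right (le_max_left _ _), fun V hV => ?_⟩
  obtain ⟨hlll, hll⟩ := hV₁ V (le_of_max_le_left hV)
  have hV2 : 2 ^ (2 ^ 9) ≤ V := le_of_max_le_right (le_of_max_le_right hV)
  have hV0 : V ≠ 0 := by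
    have : 2 ≤ V := le_of_max_le_left (le_of_max_le_right hV)
    omega
  have hN : 2 ^ 9 ≤ Nat.log 2 V := Nat.le_log_of_pow_le (by norm_num) hV2
  have hN0 : Nat.log 2 V ≠ 0 := by omega
  have hn : 9 ≤ Nat.log 2 (Nat.log 2 V) := Nat.le_log_of_pow_le (by norm_num) hN
  set n := Nat.log 2 (Nat.log 2 V) + 1 with hnd
  have hVn : 6 * n ^ n * (6 * n ^ n) ≤ V := by
    have h1 : n ^ n ≤ 2 ^ (n * n) := by
      rw [pow_mul]
      exact Nat.pow_le_pow_left Nat.lt_two_pow_self.le n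
    calc 6 * n ^ n * (6 * n ^ n) ≤ 2 ^ 3 * 2 ^ (n * n) * (2 ^ 3 * 2 ^ (n * n)) := by
          gcongr <;> norm_num
      _ = 2 ^ (2 * (n * n) + 6) := by ring
      _ ≤ 2 ^ (2 ^ (n - 1)) :=
        Nat.pow_le_pow_right (by norm_num) (two_mul_sq_add_le_two_pow (by omega))
      _ ≤ 2 ^ Nat.log 2 V :=
        Nat.pow_le_pow_right (by norm_num) (Nat.pow_log_le_self 2 hN0)
      _ ≤ V := Nat.pow_log_le_self 2 hV0
  have hsq : 6 * n ^ n ≤ V.sqrt := Nat.le_sqrt.2 hVn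
  have hpos : 0 < n ^ n := by positivity
  refine ⟨n, Nat.succ_pos _, ?_, div_nonneg hll (zero_le_one.trans hlll),
    (div_le_self hll hlll).trans ?_⟩
  · have := Nat.sqrt_le V
    nlinarith
  · have h1 : V < 2 ^ (2 ^ n) :=
      (Nat.lt_pow_succ_log_self (by norm_num) V).trans_le (Nat.pow_le_pow_right (by norm_num)
        (Nat.lt_pow_succ_log_self (by norm_num) _))
    have h2 : (V : ℝ) ≤ 2 ^ (2 ^ n) := by exact_mod_cast h1.le
    have hl2 : Real.log 2 ≤ 1 := by linarith [Real.log_two_lt_d9]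
    have hV1 : (1 : ℝ) < V := by
      have : 2 ≤ V := le_of_max_le_left (le_of_max_le_right hV)
      exact_mod_cast this
    have h3 : Real.log V ≤ 2 ^ n := by
      have := Real.log_le_log (by linarith) h2
      rw [Real.log_pow] at this
      push_cast at this
      exact this.trans (mul_le_of_le_one_right (by positivity) hl2)
    have h4 := Real.log_le_log (Real.log_pos hV1) h3
    rw [Real.log_pow] at h4
    exact h4.trans (mul_le_of_le_one_right (by positivity) hl2)

/-- **Stronger lower bound quantified in the domain size.**
There are universal constants `c > 0` and `ε₀ > 0` such that for every integer `V > 0`,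
every `ε ∈ (0, ε₀)` and every `k ≤ V`, any (randomized, measurable) test on `m` samples
from each distribution that, for every pair of distributions `p, q` on `[V] × [V]`,
distinguishes `p = q` from `‖p − q‖_{A_k} ≥ ε` with success probability at least `2/3`,
must satisfy `m ≥ c·min(k^(2/3)·ε^(−4/3)·(log log V / log log log V)^(1/3),
k^(6/7)·ε^(−8/7), k)`. -/
theorem ak_closeness_testing_lower_bound_domain :
    ∃ c ε₀ : ℝ, 0 < c ∧ 0 < ε₀ ∧
      ∀ V k : ℕ, 0 < V → k ≤ V → ∀ ε : ℝ, 0 < ε → ε < ε₀ → ∀ m : ℕ,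
        ∀ T : (Fin m → (Fin 2 → ℝ)) × (Fin m → (Fin 2 → ℝ)) → ℝ,
          Measurable T → (∀ s, T s ∈ Set.Icc (0 : ℝ) 1) →
          (∀ p q : Measure (Fin 2 → ℝ),
            IsProbabilityMeasure p → IsProbabilityMeasure q →
            GridSupported V p → GridSupported V q →
            (p = q →
              (2 : ℝ) / 3 ≤ ∫ s, T s ∂((Measure.pi fun _ : Fin m => p).prod
                  (Measure.pi fun _ : Fin m => q))) ∧
            (ε ≤ AkDist k p q →
              (2 : ℝ) / 3 ≤ ∫ s, (1 - T s) ∂((Measure.pi fun _ : Fin m => p).prod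
                  (Measure.pi fun _ : Fin m => q)))) →
          c * min ((k : ℝ) ^ ((2 : ℝ) / 3) * ε ^ (-(4 : ℝ) / 3) *
                (Real.log (Real.log V) / Real.log (Real.log (Real.log V))) ^ ((1 : ℝ) / 3))
              (min ((k : ℝ) ^ ((6 : ℝ) / 7) * ε ^ (-(8 : ℝ) / 7)) (k : ℝ)) ≤ (m : ℝ) := by
  obtain ⟨V₀, hV₀, hgrowth⟩ := exists_forall_grid_growth
  have hV₀' : (2 : ℝ) ≤ V₀ := by exact_mod_cast hV₀
  refine ⟨min (1 / 1000000) (1 / (V₀ + 1)), 1 / 368, by positivity, by norm_num, ?_⟩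
  intro V k hV hkV ε hε0 hε1 m T hT hT01 htest
  set c : ℝ := min (1 / 1000000) (1 / (V₀ + 1)) with hc
  have hc0 : 0 < c := by positivity
  have hc1 : c ≤ 1 / 1000000 := min_le_left _ _
  have hc2 : c * (V₀ + 1) ≤ 1 := by
    rw [← le_div_iff₀ (by positivity)]; exact min_le_right _ _
  set L := Real.log (Real.log V) / Real.log (Real.log (Real.log V)) with hL
  by_contra! hlt
  set A := (k : ℝ) ^ ((2 : ℝ) / 3) * ε ^ (-(4 : ℝ) / 3) * L ^ ((1 : ℝ) / 3) with hA
  set B := (k : ℝ) ^ ((6 : ℝ) / 7) * ε ^ (-(8 : ℝ) / 7) with hB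
  have hmA : (m : ℝ) < c * A :=
    hlt.trans_le (mul_le_mul_of_nonneg_left (min_le_left _ _) hc0.le)
  have hmB : (m : ℝ) < c * B := hlt.trans_le
    (mul_le_mul_of_nonneg_left ((min_le_right _ _).trans (min_le_left _ _)) hc0.le)
  have hmk : (m : ℝ) < c * k := hlt.trans_le
    (mul_le_mul_of_nonneg_left ((min_le_right _ _).trans (min_le_right _ _)) hc0.le)
  have hm0 : (0 : ℝ) ≤ m := m.cast_nonneg
  have hk : (0 : ℝ) < k := by
    by_contra! h
    nlinarith
  have hV2 : 2 ≤ V := by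
    by_contra! h
    obtain rfl : V = 1 := by omega
    have : A = 0 := by rw [hA, hL]; norm_num
    rw [this, mul_zero] at hmA
    linarith
  rcases Nat.eq_zero_or_pos m with rfl | hm
  · exact not_test_zero hV2 (by exact_mod_cast hk) (by linarith) T hT htest
  have hm1 : (1 : ℝ) ≤ m := by exact_mod_cast hm
  have hVV₀ : V₀ ≤ V := by
    by_contra! h
    have h1 : (k : ℝ) ≤ V₀ := by exact_mod_cast hkV.trans h.le
    nlinarith
  obtain ⟨n, hn, hroom, hL0, hLn⟩ := hgrowth V hVV₀
  rw [← hL] at hL0 hLn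
  have hA3 : A ^ 3 * ε ^ 4 = (k : ℝ) ^ 2 * L := by
    have e1 : ((k : ℝ) ^ ((2 : ℝ) / 3)) ^ 3 = (k : ℝ) ^ 2 := by
      rw [← Real.rpow_natCast, ← Real.rpow_mul hk.le, ← Real.rpow_natCast]; norm_num
    have e2 : (L ^ ((1 : ℝ) / 3)) ^ 3 = L := by
      rw [← Real.rpow_natCast, ← Real.rpow_mul hL0]; norm_num
    have e3 : (ε ^ (-(4 : ℝ) / 3)) ^ 3 * ε ^ 4 = 1 := by
      rw [← Real.rpow_natCast, ← Real.rpow_mul hε0.le, ← Real.rpow_natCast,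
        ← Real.rpow_add hε0]
      norm_num
    rw [hA, mul_pow, mul_pow, e1, e2]
    linear_combination (k : ℝ) ^ 2 * L * e3
  have hB7 : B ^ 7 * ε ^ 8 = (k : ℝ) ^ 6 := by
    have e1 : ((k : ℝ) ^ ((6 : ℝ) / 7)) ^ 7 = (k : ℝ) ^ 6 := by
      rw [← Real.rpow_natCast, ← Real.rpow_mul hk.le, ← Real.rpow_natCast]; norm_num
    have e3 : (ε ^ (-(8 : ℝ) / 7)) ^ 7 * ε ^ 8 = 1 := by
      rw [← Real.rpow_natCast, ← Real.rpow_mul hε0.le, ← Real.rpow_natCast,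
        ← Real.rpow_add hε0]
      norm_num
    rw [hB, mul_pow, e1]
    linear_combination (k : ℝ) ^ 6 * e3
  refine not_test_of_le hm hn hkV hroom hε0 (by linarith) (by nlinarith) ?_ ?_ T hT hT01 htest
  · have h1 : (m : ℝ) ^ 3 ≤ (c * A) ^ 3 := by gcongr
    have hkL : 0 ≤ (k : ℝ) ^ 2 * L := by positivity
    calc 400 * 768 * (368 * ε) ^ 4 * (m : ℝ) ^ 3
        ≤ 400 * 768 * (368 * ε) ^ 4 * (c * A) ^ 3 := by gcongr
      _ = 400 * 768 * 368 ^ 4 * c ^ 3 * ((k : ℝ) ^ 2 * L) := by rw [← hA3]; ring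
      _ ≤ 400 * 768 * 368 ^ 4 * (1 / 1000000) ^ 3 * ((k : ℝ) ^ 2 * L) := by gcongr
      _ ≤ (k : ℝ) ^ 2 * L := mul_le_of_le_one_left hkL (by norm_num)
      _ ≤ (k : ℝ) ^ 2 * n := by gcongr
      _ = n * (k : ℝ) ^ 2 := mul_comm _ _
  · have h1 : (m : ℝ) ^ 7 ≤ (c * B) ^ 7 := by gcongr
    have hk6 : 0 ≤ (k : ℝ) ^ 6 := by positivity
    calc 400 * 1024 * (368 * ε) ^ 8 * (m : ℝ) ^ 7
        ≤ 400 * 1024 * (368 * ε) ^ 8 * (c * B) ^ 7 := by gcongr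
      _ = 400 * 1024 * 368 ^ 8 * c ^ 7 * (k : ℝ) ^ 6 := by rw [← hB7]; ring
      _ ≤ 400 * 1024 * 368 ^ 8 * (1 / 1000000) ^ 7 * (k : ℝ) ^ 6 := by gcongr
      _ ≤ (k : ℝ) ^ 6 := mul_le_of_le_one_left hk6 (by norm_num)
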